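/- arXiv:1108.5129 — 5 statements merged into one kernel-verified Lean document; each statement's English description precedes it below -/
import Mathlib

section
/- For α ∈ ℝ define C_α := inf over integers p ≥ 0 and q ∈ ℤ of |(2p+1)α − 2q|. If α = μ/ν where μ ∈ ℤ and ν ∈ ℕ₊ are coprime and μ is odd, then C_α = 1/ν. In all other cases (α a rational whose reduced fraction has even numerator, or α irrational), C_α = 0. -/
noncomputable section

/-- The large-`N` statistics constant `C_α := inf_{p ∈ ℕ, q ∈ ℤ} |(2p+1)α - 2q|`. -/
def Calpha (α : ℝ) : ℝ :=
  ⨅ p : ℕ, ⨅ q : ℤ, |(2 * (p : ℝ) + 1) * α - 2 * (q : ℝ)|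

theorem Calpha_nonneg (α : ℝ) : 0 ≤ Calpha α :=
  Real.iInf_nonneg fun _ => Real.iInf_nonneg fun _ => abs_nonneg _

theorem Calpha_le_natCast (α : ℝ) (p : ℕ) (q : ℤ) :
    Calpha α ≤ |(2 * (p : ℝ) + 1) * α - 2 * (q : ℝ)| := by
  refine (ciInf_le ⟨0, ?_⟩ p).trans (ciInf_le ⟨0, ?_⟩ q)
  · rintro _ ⟨p, rfl⟩
    exact Real.iInf_nonneg fun _ => abs_nonneg _
  · rintro _ ⟨q, rfl⟩
    exact abs_nonneg _

/-- Negative odd multiples of `α` are also admissible, by symmetry. -/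
theorem Calpha_le_intCast (α : ℝ) (m q : ℤ) :
    Calpha α ≤ |(2 * (m : ℝ) + 1) * α - 2 * (q : ℝ)| := by
  rcases le_or_gt 0 m with hm | hm
  · lift m to ℕ using hm
    simpa using Calpha_le_natCast α m q
  · obtain ⟨p, hp⟩ := Int.eq_ofNat_of_zero_le (show 0 ≤ -m - 1 by lia)
    have hp' : (p : ℝ) = -m - 1 := by exact_mod_cast hp.symm
    refine (Calpha_le_natCast α p (-q)).trans_eq ?_
    rw [← abs_neg, hp']
    push_cast
    congr 1
    ring

theorem Calpha_of_irrational {α : ℝ} (h : Irrational α) : Calpha α = 0 := by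
  refine le_antisymm (le_of_forall_pos_le_add fun ε hε => ?_) (Calpha_nonneg α)
  have hd : Dense (AddSubgroup.closure {2 * α, 2} : Set ℝ) := by
    rw [dense_addSubgroupClosure_pair_iff]
    simpa using h
  obtain ⟨x, hx, hxε⟩ := hd.exists_dist_lt (-α) hε
  obtain ⟨m, n, rfl⟩ := AddSubgroup.mem_closure_pair.mp hx
  refine (Calpha_le_intCast α m (-n)).trans ?_
  rw [dist_comm, Real.dist_eq] at hxε
  rw [zero_add]
  convert hxε.le using 2
  simp only [zsmul_eq_mul]
  push_cast
  ring

theorem Calpha_of_odd_numerator {μ : ℤ} {ν : ℕ} (hν : 0 < ν) (hc : IsCoprime μ (ν : ℤ))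
    (hμ : Odd μ) : Calpha ((μ : ℝ) / (ν : ℝ)) = 1 / (ν : ℝ) := by
  have hν' : (0 : ℝ) < ν := by exact_mod_cast hν
  have key (m q : ℤ) : |(2 * (m : ℝ) + 1) * ((μ : ℝ) / ν) - 2 * (q : ℝ)| =
      ((|(2 * m + 1) * μ - 2 * q * ν| : ℤ) : ℝ) / ν := by
    push_cast
    rw [← abs_of_pos hν', ← abs_div, abs_of_pos hν']
    congr 1
    field_simp
  apply le_antisymm
  · obtain ⟨a, b, hab⟩ := (Int.isCoprime_two_right.mpr hμ).mul_right hc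
    obtain ⟨m, rfl⟩ : Odd a := by
      have : Odd (a * μ) := ⟨-(b * ν), by linear_combination hab⟩
      exact (Int.odd_mul.mp this).1
    refine (Calpha_le_intCast _ m (-b)).trans_eq ?_
    rw [key, show (2 * m + 1) * μ - 2 * -b * ν = 1 by linear_combination hab]
    simp
  · refine le_ciInf fun p => le_ciInf fun q => ?_
    have hodd : Odd ((2 * (p : ℤ) + 1) * μ - 2 * q * ν) :=
      ((odd_two_mul_add_one _).mul hμ).sub_even ⟨q * ν, by ring⟩
    have h1 : (1 : ℤ) ≤ |(2 * (p : ℤ) + 1) * μ - 2 * q * ν| :=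
      Int.one_le_abs fun h0 => by simp [h0] at hodd
    have hk := key p q
    rw [Int.cast_natCast] at hk
    rw [hk]
    gcongr
    exact_mod_cast h1

theorem Calpha_of_even_numerator {μ : ℤ} {ν : ℕ} (hν : Odd ν) (hμ : Even μ) :
    Calpha ((μ : ℝ) / (ν : ℝ)) = 0 := by
  have hν' : (ν : ℝ) ≠ 0 := by exact_mod_cast hν.pos.ne'
  obtain ⟨p, rfl⟩ := hν
  obtain ⟨q, rfl⟩ := hμ
  refine le_antisymm ((Calpha_le_natCast _ p q).trans_eq ?_) (Calpha_nonneg _)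
  push_cast at hν' ⊢
  rw [mul_div_cancel₀ _ hν', abs_eq_zero]
  ring

/-- **Proposition.** `C_α = 1/ν` if `α = μ/ν` is a reduced fraction with odd numerator `μ`
and positive denominator `ν`; in all other cases (even-numerator rationals and irrationals)
`C_α = 0`. -/
theorem Calpha_eq_one_div_of_odd_numerator_and_zero_otherwise (α : ℝ) :
    (∀ (μ : ℤ) (ν : ℕ), 0 < ν → Int.gcd μ (ν : ℤ) = 1 → Odd μ →
        α = (μ : ℝ) / (ν : ℝ) → Calpha α = 1 / (ν : ℝ)) ∧
    ((¬ ∃ (μ : ℤ) (ν : ℕ), 0 < ν ∧ Int.gcd μ (ν : ℤ) = 1 ∧ Odd μ ∧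
        α = (μ : ℝ) / (ν : ℝ)) → Calpha α = 0) := by
  refine ⟨fun μ ν hν hc hμ h => ?_, fun h => ?_⟩
  · rw [h]
    exact Calpha_of_odd_numerator hν (Int.isCoprime_iff_gcd_eq_one.mpr hc) hμ
  · by_cases hα : Irrational α
    · exact Calpha_of_irrational hα
    · obtain ⟨r, rfl⟩ := not_not.mp hα
      have hc : Int.gcd r.num (r.den : ℤ) = 1 := by simpa [Int.gcd] using r.reduced
      have hr : (r : ℝ) = (r.num : ℝ) / (r.den : ℝ) := Rat.cast_def r
      have heven : Even r.num := by
        by_contra hodd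
        exact h ⟨r.num, r.den, r.den_pos, hc, Int.not_even_iff_odd.mp hodd, hr⟩
      have hden : Odd r.den := by
        by_contra hden
        have h2 : (2 : ℤ) ∣ r.den := by exact_mod_cast (Nat.not_odd_iff_even.mp hden).two_dvd
        have := Int.dvd_coe_gcd heven.two_dvd h2
        rw [hc] at this
        norm_num at this
      rw [hr]
      exact Calpha_of_even_numerator hden heven

end
end

section
/- Let 0 ≤ R₁ < R₂ ≤ ∞ and let Ω := {r ∈ ℝ² : R₁ < |r| < R₂} be the corresponding annular domain. Let a : Ω → ℝ² be a smooth vector field with vanishing curl on Ω (∂₁a₂ − ∂₂a₁ = 0), whose circulation along every circle of radius s ∈ (R₁,R₂) centered at 0 equals a fixed number Φ ∈ ℝ (i.e. ∫₀^{2π} a(s cos θ, s sin θ)·(−sin θ, cos θ) s dθ = Φ for all s ∈ (R₁,R₂)), and which is antipodal-antisymmetric: a(−r) = −a(r) for all r ∈ Ω. Let v : Ω → ℂ be smooth and antipodal-symmetric: v(−r) = v(r) for all r ∈ Ω. Then ∫_Ω |(−i∇ + a)v|² dr ≥ (min_{k ∈ ℤ} |Φ/(2π) − 2k|²) ∫_Ω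 |v(r)|²/|r|² dr, where both sides are interpreted as integrals with values in [0,∞]. -/
open MeasureTheory ENNReal

noncomputable section

/-- Integration by parts for Fourier coefficients, including the zeroth one. -/
theorem fourierCoeffOn_deriv_of_endpoints_eq {a b : ℝ} (hab : a < b) {f f' : ℝ → ℂ} (n : ℤ)
    (hf : ∀ x, HasDerivAt f (f' x) x) (hf' : Continuous f') (hend : f b = f a) :
    fourierCoeffOn hab f' n =
      2 * Real.pi * Complex.I * n / (b - a) * fourierCoeffOn hab f n := by
  have hba : ((b : ℂ) - a) ≠ 0 := by exact_mod_cast (sub_pos.2 hab).ne'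
  rcases eq_or_ne n 0 with rfl | hn
  · rw [fourierCoeffOn_eq_integral]
    have := intervalIntegral.integral_eq_sub_of_hasDerivAt (fun x _ => hf x)
      (hf'.intervalIntegrable a b)
    simp [this, hend]
  · rw [fourierCoeffOn_of_hasDerivAt hab hn (fun x _ => hf x) (hf'.intervalIntegrable a b), hend]
    have hn' : (n : ℂ) ≠ 0 := by exact_mod_cast hn
    have hpi : (Real.pi : ℂ) ≠ 0 := by exact_mod_cast Real.pi_ne_zero
    field_simp
    simp

theorem fourierCoeffOn_add_of_continuous {a b : ℝ} (hab : a < b) {f g : ℝ → ℂ} (n : ℤ)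
    (hf : Continuous f) (hg : Continuous g) :
    fourierCoeffOn hab (fun x => f x + g x) n = fourierCoeffOn hab f n + fourierCoeffOn hab g n := by
  simp only [fourierCoeffOn_eq_integral, smul_eq_mul, mul_add]
  have hc : Continuous fun x : ℝ => fourier (-n) (x : AddCircle (b - a)) :=
    (map_continuous _).comp (AddCircle.continuous_mk' _)
  rw [← smul_add]
  congr 1
  exact intervalIntegral.integral_add ((hc.mul hf).intervalIntegrable _ _)
    ((hc.mul hg).intervalIntegrable _ _)

theorem hasSum_sq_fourierCoeffOn_of_continuous {a b : ℝ} (hab : a < b) {f : ℝ → ℂ}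
    (hf : Continuous f) :
    HasSum (fun i => ‖fourierCoeffOn hab f i‖ ^ 2) ((b - a)⁻¹ • ∫ x in a..b, ‖f x‖ ^ 2) := by
  refine hasSum_sq_fourierCoeffOn hab ?_
  refine (memLp_two_iff_integrable_sq_norm hf.aestronglyMeasurable).2 ?_
  exact ((hf.norm.pow 2).intervalIntegrable a b).1

/-- Spectral bound for the twisted derivative `g ↦ g' + iαg` with periodic boundary conditions. -/
theorem integral_sq_norm_le_integral_sq_norm_twisted_deriv {T α c : ℝ} (hT : 0 < T)
    (hc : ∀ n : ℤ, c ≤ (α + 2 * Real.pi * n / T) ^ 2) {g g' : ℝ → ℂ}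
    (hg : ∀ x, HasDerivAt g (g' x) x) (hg' : Continuous g') (hend : g T = g 0) :
    c * ∫ x in 0..T, ‖g x‖ ^ 2 ≤ ∫ x in 0..T, ‖g' x + Complex.I * α * g x‖ ^ 2 := by
  have hgc : Continuous g := continuous_iff_continuousAt.2 fun x => (hg x).continuousAt
  have hgc' : Continuous fun x => Complex.I * α * g x := continuous_const.mul hgc
  have hcoeff (n : ℤ) : fourierCoeffOn hT (fun x => g' x + Complex.I * α * g x) n =
      Complex.I * ((α + 2 * Real.pi * n / T : ℝ) : ℂ) * fourierCoeffOn hT g n := by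
    rw [fourierCoeffOn_add_of_continuous hT n hg' hgc', fourierCoeffOn.const_mul,
      fourierCoeffOn_deriv_of_endpoints_eq hT n hg hg' hend]
    push_cast
    ring
  have h1 := (hasSum_sq_fourierCoeffOn_of_continuous hT hgc).mul_left c
  have h2 := hasSum_sq_fourierCoeffOn_of_continuous hT (hg'.add hgc')
  have h3 := hasSum_le (fun n => ?_) h1 h2
  · simp only [smul_eq_mul, sub_zero] at h3
    have := mul_le_mul_of_nonneg_left h3 hT.le
    field_simp at this
    exact this
  · rw [show (g' + fun x => Complex.I * α * g x) = fun x => g' x + Complex.I * α * g x from rfl,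
      hcoeff, norm_mul, norm_mul, Complex.norm_I, one_mul, mul_pow, Complex.norm_real,
      Real.norm_eq_abs, sq_abs]
    exact mul_le_mul_of_nonneg_right (hc n) (sq_nonneg _)

/-- One-dimensional magnetic Poincaré inequality on a circle of length `T`, where `α` is the mean
of the magnetic potential `A`. -/
theorem integral_sq_norm_le_integral_sq_norm_magnetic_deriv {T α c : ℝ} (hT : 0 < T)
    (hc : ∀ n : ℤ, c ≤ (α + 2 * Real.pi * n / T) ^ 2) {u u' : ℝ → ℂ} {A : ℝ → ℝ}
    (hu : ∀ x, HasDerivAt u (u' x) x) (hu' : Continuous u') (hend : u T = u 0)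
    (hA : Continuous A) (hα : ∫ x in 0..T, A x = T * α) :
    c * ∫ x in 0..T, ‖u x‖ ^ 2 ≤ ∫ x in 0..T, ‖-Complex.I * u' x + A x * u x‖ ^ 2 := by
  have huc : Continuous u := continuous_iff_continuousAt.2 fun x => (hu x).continuousAt
  set φ : ℝ → ℝ := fun x => (∫ t in 0..x, A t) - α * x with hφdef
  have hφ (x : ℝ) : HasDerivAt φ (A x - α) x := by
    have := (intervalIntegral.integral_hasDerivAt_right (hA.intervalIntegrable 0 x)
      (hA.stronglyMeasurableAtFilter _ _) hA.continuousAt).sub ((hasDerivAt_id x).const_mul α)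
    exact this.congr_deriv (by simp)
  have hφc : Continuous φ := continuous_iff_continuousAt.2 fun x => (hφ x).continuousAt
  set e : ℝ → ℂ := fun x => Complex.exp (φ x * Complex.I) with hedef
  have he (x : ℝ) : HasDerivAt e (e x * (((A x - α : ℝ) : ℂ) * Complex.I)) x :=
    ((hφ x).ofReal_comp.mul_const Complex.I).cexp
  have hec : Continuous e := by fun_prop
  have hnorm (x : ℝ) : ‖e x‖ = 1 := Complex.norm_exp_ofReal_mul_I _
  have key := integral_sq_norm_le_integral_sq_norm_twisted_deriv hT hc
    (g := fun x => e x * u x)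
    (g' := fun x => e x * (((A x - α : ℝ) : ℂ) * Complex.I) * u x + e x * u' x)
    (fun x => (he x).mul (hu x)) (by fun_prop)
    (by simp [hedef, hφdef, hα, hend, mul_comm])
  refine le_of_eq_of_le ?_ (key.trans_eq ?_)
  · simp [hnorm]
  · refine intervalIntegral.integral_congr fun x _ => ?_
    have : e x * (((A x - α : ℝ) : ℂ) * Complex.I) * u x + e x * u' x
        + Complex.I * α * (e x * u x) =
        e x * (Complex.I * (-Complex.I * u' x + A x * u x)) := by
      push_cast
      linear_combination (e x * u' x) * Complex.I_mul_I
    simp only [this, norm_mul, hnorm, Complex.norm_I, one_mul]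

theorem sq_norm_real_combination_le {x y : ℝ} (hxy : x ^ 2 + y ^ 2 = 1) (p q : ℂ) :
    ‖(x : ℂ) * p + y * q‖ ^ 2 ≤ ‖p‖ ^ 2 + ‖q‖ ^ 2 := by
  have h : ‖(x : ℂ) * p + y * q‖ ≤ |x| * ‖p‖ + |y| * ‖q‖ := by
    refine (norm_add_le _ _).trans ?_
    simp
  refine (pow_le_pow_left₀ (norm_nonneg _) h 2).trans ?_
  rw [← sq_abs x, ← sq_abs y] at hxy
  nlinarith [sq_nonneg (|x| * ‖q‖ - |y| * ‖p‖), congrArg (· * (‖p‖ ^ 2 + ‖q‖ ^ 2)) hxy]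


theorem Function.Periodic.deriv_of_hasDerivAt {u u' : ℝ → ℂ} {T : ℝ} (hper : Function.Periodic u T)
    (hu : ∀ x, HasDerivAt u (u' x) x) : Function.Periodic u' T := fun x => by
  have h := (hu (x + T)).comp_add_const x T
  simp only [hper _] at h
  exact h.unique (hu x)

theorem Function.Periodic.intervalIntegral_two_periods {f : ℝ → ℝ} {T : ℝ}
    (hper : Function.Periodic f T) (hf : Continuous f) (t : ℝ) :
    ∫ x in t..t + 2 * T, f x = 2 * ∫ x in 0..T, f x := by
  have h := hper.intervalIntegral_add_zsmul_eq 2 t fun t₁ t₂ => hf.intervalIntegrable t₁ t₂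
  rw [hper.intervalIntegral_add_eq t 0] at h
  simpa using h

/-- Magnetic Hardy inequality on a single circle centered at the origin. -/
theorem integral_circle_magnetic_hardy {Ω : Set ℂ} (hΩ : IsOpen Ω) {s c Φ : ℝ} (hs : 0 < s)
    (hmem : ∀ θ : ℝ, (s : ℂ) * Complex.exp (θ * Complex.I) ∈ Ω)
    (hc : ∀ k : ℤ, c ≤ |Φ / (2 * Real.pi) - 2 * (k : ℝ)| ^ 2)
    {a v : ℂ → ℂ} (ha : ContinuousOn a Ω) (hv : ContDiffOn ℝ (⊤ : ℕ∞) v Ω)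
    (ha_circ : (∫ θ in (0 : ℝ)..(2 * Real.pi),
        (a ((s : ℂ) * Complex.exp ((θ : ℂ) * Complex.I)) *
          starRingEnd ℂ (Complex.I * Complex.exp ((θ : ℂ) * Complex.I))).re * s) = Φ)
    (ha_anti : ∀ r ∈ Ω, a (-r) = -a r) (hv_symm : ∀ r ∈ Ω, v (-r) = v r) :
    ENNReal.ofReal c * ∫⁻ θ in Set.Ioo (-Real.pi) Real.pi,
        ENNReal.ofReal (‖v (s * Complex.exp (θ * Complex.I))‖ ^ 2 /
          ‖(s : ℂ) * Complex.exp (θ * Complex.I)‖ ^ 2) ≤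
      ∫⁻ θ in Set.Ioo (-Real.pi) Real.pi, ENNReal.ofReal
        (‖-Complex.I * fderiv ℝ v (s * Complex.exp (θ * Complex.I)) 1 +
            ((a (s * Complex.exp (θ * Complex.I))).re : ℂ) *
              v (s * Complex.exp (θ * Complex.I))‖ ^ 2 +
         ‖-Complex.I * fderiv ℝ v (s * Complex.exp (θ * Complex.I)) Complex.I +
            ((a (s * Complex.exp (θ * Complex.I))).im : ℂ) *
              v (s * Complex.exp (θ * Complex.I))‖ ^ 2) := by
  set γ : ℝ → ℂ := fun θ => (s : ℂ) * Complex.exp (θ * Complex.I) with hγdef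
  have hγc : Continuous γ := by fun_prop
  have hγmem (θ : ℝ) : γ θ ∈ Ω := hmem θ
  have hγanti : ∀ θ, γ (θ + Real.pi) = -γ θ := fun θ => by
    simp [hγdef, add_mul, Complex.exp_add]
  have hγre (θ : ℝ) : γ θ = s * Real.cos θ + s * Real.sin θ * Complex.I := by
    simp only [hγdef, Complex.exp_mul_I]
    push_cast
    ring
  have hγ (θ : ℝ) : HasDerivAt γ (Complex.I * γ θ) θ := by
    have h := ((hasDerivAt_id θ).ofReal_comp.mul_const Complex.I).cexp.const_mul (s : ℂ)
    refine h.congr_deriv ?_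
    simp [hγdef]
    ring
  have hγnorm (θ : ℝ) : ‖γ θ‖ = s := by
    simp [hγdef, Complex.norm_exp_ofReal_mul_I, abs_of_pos hs]
  have haγ : Continuous fun θ => a (γ θ) := ha.comp_continuous hγc hγmem
  have hvγ : Continuous fun θ => v (γ θ) := hv.continuousOn.comp_continuous hγc hγmem
  have hdvγ : Continuous fun θ => fderiv ℝ v (γ θ) :=
    (hv.continuousOn_fderiv_of_isOpen hΩ (by simp)).comp_continuous hγc hγmem
  have hdv (r : ℂ) (hr : r ∈ Ω) : HasFDerivAt v (fderiv ℝ v r) r :=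
    ((hv.contDiffAt (hΩ.mem_nhds hr)).differentiableAt (by simp)).hasFDerivAt
  have hu (θ : ℝ) : HasDerivAt (fun θ => v (γ θ)) (fderiv ℝ v (γ θ) (Complex.I * γ θ)) θ :=
    (hdv _ (hγmem θ)).comp_hasDerivAt θ (hγ θ)
  set A : ℝ → ℝ := fun θ =>
    (a (γ θ) * starRingEnd ℂ (Complex.I * Complex.exp (θ * Complex.I))).re * s with hAdef
  have hAc : Continuous A := by
    refine (Complex.continuous_re.comp (haγ.mul ?_)).mul continuous_const
    exact Complex.continuous_conj.comp (by fun_prop)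
  have huper : Function.Periodic (fun θ => v (γ θ)) Real.pi := fun θ => by
    simp only [hγanti, hv_symm _ (hγmem θ)]
  have hAper : Function.Periodic A Real.pi := fun θ => by
    simp only [hAdef, hγanti, ha_anti _ (hγmem θ)]
    simp [add_mul, Complex.exp_add]
  have hu'per := huper.deriv_of_hasDerivAt hu
  have hu'c : Continuous fun θ => fderiv ℝ v (γ θ) (Complex.I * γ θ) := by fun_prop
  have hmean : ∫ θ in 0..Real.pi, A θ = Real.pi * (Φ / (2 * Real.pi)) := by
    have h := hAper.intervalIntegral_two_periods hAc 0
    rw [zero_add, ha_circ] at h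
    rw [h]
    field_simp
  set N : ℝ → ℝ := fun θ =>
    ‖-Complex.I * fderiv ℝ v (γ θ) (Complex.I * γ θ) + A θ * v (γ θ)‖ ^ 2 with hNdef
  have hNc : Continuous N :=
    ((continuous_const.mul hu'c).add ((Complex.continuous_ofReal.comp hAc).mul hvγ)).norm.pow 2
  have hNper : Function.Periodic N Real.pi := fun θ => by
    have h1 := huper θ
    have h2 := hu'per θ
    simp only at h1 h2
    simp only [hNdef, h1, h2, hAper θ]
  have key := integral_sq_norm_le_integral_sq_norm_magnetic_deriv (c := c) Real.pi_pos
    (fun n => by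
      refine (hc (-n)).trans_eq ?_
      rw [sq_abs]
      push_cast
      field_simp
      ring) hu hu'c (by simpa using huper 0) hAc hmean
  have hpp (f : ℝ → ℝ) (hf : Continuous f) (hper : Function.Periodic f Real.pi) :
      ∫ θ in -Real.pi..Real.pi, f θ = 2 * ∫ θ in 0..Real.pi, f θ := by
    rw [← hper.intervalIntegral_two_periods hf (-Real.pi)]
    ring_nf
  have key2 : c * ∫ θ in -Real.pi..Real.pi, ‖v (γ θ)‖ ^ 2 ≤ ∫ θ in -Real.pi..Real.pi, N θ := by
    rw [hpp _ hNc hNper, hpp (fun θ => ‖v (γ θ)‖ ^ 2) (hvγ.norm.pow 2)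
      (fun θ => congrArg (‖·‖ ^ 2) (huper θ))]
    linarith
  set G : ℝ → ℝ := fun θ =>
    ‖-Complex.I * fderiv ℝ v (γ θ) 1 + ((a (γ θ)).re : ℂ) * v (γ θ)‖ ^ 2 +
      ‖-Complex.I * fderiv ℝ v (γ θ) Complex.I + ((a (γ θ)).im : ℂ) * v (γ θ)‖ ^ 2 with hGdef
  have hGc : Continuous G := by
    have hd (w : ℂ) : Continuous fun θ => fderiv ℝ v (γ θ) w := hdvγ.clm_apply continuous_const
    have h1 := Complex.continuous_ofReal.comp (Complex.continuous_re.comp haγ)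
    have h2 := Complex.continuous_ofReal.comp (Complex.continuous_im.comp haγ)
    exact (((continuous_const.mul (hd 1)).add (h1.mul hvγ)).norm.pow 2).add
      (((continuous_const.mul (hd Complex.I)).add (h2.mul hvγ)).norm.pow 2)
  have hNG (θ : ℝ) : N θ / s ^ 2 ≤ G θ := by
    have hcomb := sq_norm_real_combination_le (x := -Real.sin θ) (y := Real.cos θ)
      (by nlinarith [Real.sin_sq_add_cos_sq θ])
      (-Complex.I * fderiv ℝ v (γ θ) 1 + ((a (γ θ)).re : ℂ) * v (γ θ))
      (-Complex.I * fderiv ℝ v (γ θ) Complex.I + ((a (γ θ)).im : ℂ) * v (γ θ))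
    refine le_of_eq_of_le ?_ hcomb
    have hdir : fderiv ℝ v (γ θ) (Complex.I * γ θ) =
        s * (-Real.sin θ * fderiv ℝ v (γ θ) 1 + Real.cos θ * fderiv ℝ v (γ θ) Complex.I) := by
      have : Complex.I * γ θ =
          (-(s * Real.sin θ)) • (1 : ℂ) + (s * Real.cos θ) • Complex.I := by
        rw [hγre]
        simp only [Complex.real_smul]
        push_cast
        linear_combination (s * Complex.sin θ) * Complex.I_mul_I
      rw [this, map_add, map_smul, map_smul]
      simp only [Complex.real_smul]
      push_cast
      ring
    have hAθ : A θ = s * (-Real.sin θ * (a (γ θ)).re + Real.cos θ * (a (γ θ)).im) := by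
      simp only [hAdef, Complex.exp_mul_I]
      simp [← Complex.ofReal_cos, ← Complex.ofReal_sin]
      ring
    have hfac : -Complex.I * fderiv ℝ v (γ θ) (Complex.I * γ θ) + A θ * v (γ θ) =
        s * (((-Real.sin θ : ℝ) : ℂ) *
          (-Complex.I * fderiv ℝ v (γ θ) 1 + ((a (γ θ)).re : ℂ) * v (γ θ)) +
          (Real.cos θ : ℂ) *
          (-Complex.I * fderiv ℝ v (γ θ) Complex.I + ((a (γ θ)).im : ℂ) * v (γ θ))) := by
      rw [hdir, hAθ]
      push_cast
      ring
    simp only [hNdef, hfac, norm_mul, mul_pow, Complex.norm_real, Real.norm_eq_abs, sq_abs]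
    field_simp
  have hpi : -Real.pi ≤ Real.pi := by linarith [Real.pi_pos]
  have hlin (f : ℝ → ℝ) (hf : Continuous f) (hf0 : ∀ θ, 0 ≤ f θ) :
      ∫⁻ θ in Set.Ioo (-Real.pi) Real.pi, ENNReal.ofReal (f θ) =
        ENNReal.ofReal (∫ θ in -Real.pi..Real.pi, f θ) := by
    rw [intervalIntegral.integral_of_le hpi,
      ofReal_integral_eq_lintegral_ofReal (hf.intervalIntegrable _ _).1 (ae_of_all _ hf0),
      restrict_Ioo_eq_restrict_Ioc]
  change ENNReal.ofReal c * ∫⁻ θ in Set.Ioo (-Real.pi) Real.pi,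
      ENNReal.ofReal (‖v (γ θ)‖ ^ 2 / ‖γ θ‖ ^ 2) ≤
    ∫⁻ θ in Set.Ioo (-Real.pi) Real.pi, ENNReal.ofReal (G θ)
  simp only [hγnorm]
  rw [hlin (fun θ => ‖v (γ θ)‖ ^ 2 / s ^ 2) ((hvγ.norm.pow 2).div_const _) (fun θ => by positivity),
    hlin G hGc (fun θ => by positivity), ← ENNReal.ofReal_mul' (by
      exact intervalIntegral.integral_nonneg hpi fun θ _ => by positivity)]
  refine ENNReal.ofReal_le_ofReal ?_
  calc c * ∫ θ in -Real.pi..Real.pi, ‖v (γ θ)‖ ^ 2 / s ^ 2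
      = (c * ∫ θ in -Real.pi..Real.pi, ‖v (γ θ)‖ ^ 2) / s ^ 2 := by
        rw [intervalIntegral.integral_div, mul_div_assoc]
    _ ≤ (∫ θ in -Real.pi..Real.pi, N θ) / s ^ 2 := by gcongr
    _ = ∫ θ in -Real.pi..Real.pi, N θ / s ^ 2 := by rw [intervalIntegral.integral_div]
    _ ≤ ∫ θ in -Real.pi..Real.pi, G θ :=
        intervalIntegral.integral_mono hpi ((hNc.div_const _).intervalIntegrable _ _)
          (hGc.intervalIntegrable _ _) hNG

theorem lintegral_eq_lintegral_circles {f : ℂ → ℝ≥0∞} (hf : Measurable f) :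
    ∫⁻ r, f r = ∫⁻ s in Set.Ioi (0 : ℝ), ENNReal.ofReal s *
      ∫⁻ θ in Set.Ioo (-Real.pi) Real.pi, f (s * Complex.exp (θ * Complex.I)) := by
  have hpolar (p : ℝ × ℝ) :
      Complex.polarCoord.symm p = (p.1 : ℂ) * Complex.exp (p.2 * Complex.I) := by
    rw [Complex.polarCoord_symm_apply, Complex.exp_mul_I]
    push_cast
    rfl
  rw [← Complex.lintegral_comp_polarCoord_symm, polarCoord_target]
  simp only [hpolar, smul_eq_mul]
  rw [Measure.volume_eq_prod, setLIntegral_prod _ (by fun_prop)]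
  refine lintegral_congr fun s => ?_
  dsimp only
  rw [lintegral_const_mul _ (by fun_prop)]

/-- In polar coordinates, an inequality between circular integrals of functions supported in a
measurable set yields the inequality between area integrals. -/
theorem mul_setLIntegral_le_of_forall_circle {Ω : Set ℂ} (hΩ : MeasurableSet Ω) (C : ℝ≥0∞)
    {f g : ℂ → ℝ≥0∞} (hf : Measurable (Ω.indicator f)) (hg : Measurable (Ω.indicator g))
    (h : ∀ s : ℝ, 0 < s →
      C * ∫⁻ θ in Set.Ioo (-Real.pi) Real.pi, Ω.indicator f (s * Complex.exp (θ * Complex.I)) ≤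
        ∫⁻ θ in Set.Ioo (-Real.pi) Real.pi, Ω.indicator g (s * Complex.exp (θ * Complex.I))) :
    C * ∫⁻ r in Ω, f r ≤ ∫⁻ r in Ω, g r := by
  rw [← lintegral_indicator hΩ, ← lintegral_indicator hΩ, ← lintegral_const_mul _ hf,
    lintegral_eq_lintegral_circles (hf.const_mul C), lintegral_eq_lintegral_circles hg]
  refine setLIntegral_mono' measurableSet_Ioi fun s hs => ?_
  rw [lintegral_const_mul _ (by fun_prop)]
  gcongr
  exact h s hs

theorem ContinuousOn.measurable_indicator_ofReal {Ω : Set ℂ} (hΩ : IsOpen Ω) {f : ℂ → ℝ}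
    (hf : ContinuousOn f Ω) : Measurable (Ω.indicator fun r => ENNReal.ofReal (f r)) := by
  classical
  rw [← Set.piecewise_eq_indicator]
  exact (ENNReal.continuous_ofReal.comp_continuousOn hf).measurable_piecewise
    continuous_zero.continuousOn hΩ.measurableSet

/-- **Lemma (magnetic Hardy inequality with antipodal symmetry, symmetric case).**
On the annulus `Ω = {R₁ < |r| < R₂}` (with `R₂ ∈ (R₁,∞]`), for a smooth curl-free
vector field `a` (identified with a complex-valued function, components `re`/`im`)
with constant circulation `Φ` around the inner disk which is antipodal-antisymmetric,
and a smooth antipodal-symmetric function `v`, one has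
`∫_Ω |(-i∇ + a)v|² ≥ (min_{k ∈ ℤ} |Φ/2π - 2k|²) ∫_Ω |v|²/|r|²`,
both sides interpreted as integrals with values in `[0,∞]`. -/
theorem magnetic_hardy_symmetric
    (R₁ : ℝ) (R₂ : ℝ≥0∞) (hR₁ : 0 ≤ R₁) (hR₁₂ : ENNReal.ofReal R₁ < R₂)
    (Ω : Set ℂ) (hΩ : Ω = {r : ℂ | R₁ < ‖r‖ ∧ ENNReal.ofReal ‖r‖ < R₂})
    (Φ : ℝ) (a : ℂ → ℂ)
    (ha_smooth : ContDiffOn ℝ (⊤ : ℕ∞) a Ω)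
    (ha_curl : ∀ r ∈ Ω,
      fderiv ℝ (fun z => (a z).im) r 1 - fderiv ℝ (fun z => (a z).re) r Complex.I = 0)
    (ha_circ : ∀ s : ℝ, R₁ < s → ENNReal.ofReal s < R₂ →
      (∫ θ in (0:ℝ)..(2 * Real.pi),
        (a ((s : ℂ) * Complex.exp ((θ : ℂ) * Complex.I)) *
          starRingEnd ℂ (Complex.I * Complex.exp ((θ : ℂ) * Complex.I))).re * s) = Φ)
    (ha_anti : ∀ r ∈ Ω, a (-r) = -a r)
    (v : ℂ → ℂ)
    (hv_smooth : ContDiffOn ℝ (⊤ : ℕ∞) v Ω)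
    (hv_symm : ∀ r ∈ Ω, v (-r) = v r) :
    ENNReal.ofReal (⨅ k : ℤ, |Φ / (2 * Real.pi) - 2 * (k : ℝ)| ^ 2) *
        ∫⁻ r in Ω, ENNReal.ofReal (‖v r‖ ^ 2 / ‖r‖ ^ 2) ≤
      ∫⁻ r in Ω, ENNReal.ofReal
        (‖-Complex.I * fderiv ℝ v r 1 + ((a r).re : ℂ) * v r‖ ^ 2 +
         ‖-Complex.I * fderiv ℝ v r Complex.I + ((a r).im : ℂ) * v r‖ ^ 2) := by
  have hset : IsOpen Ω := by
    rw [hΩ]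
    exact (isOpen_lt continuous_const continuous_norm).inter
      (isOpen_lt (ENNReal.continuous_ofReal.comp continuous_norm) continuous_const)
  have hne (r : ℂ) (hr : r ∈ Ω) : ‖r‖ ^ 2 ≠ 0 := by
    rw [hΩ] at hr
    exact pow_ne_zero 2 (hR₁.trans_lt hr.1).ne'
  have hdv (w : ℂ) : ContinuousOn (fun r => fderiv ℝ v r w) Ω :=
    (hv_smooth.continuousOn_fderiv_of_isOpen hset (by simp)).clm_apply continuousOn_const
  have ha := ha_smooth.continuousOn
  have hv := hv_smooth.continuousOn
  have hre := Complex.continuous_ofReal.comp_continuousOn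
    (Complex.continuous_re.comp_continuousOn ha)
  have him := Complex.continuous_ofReal.comp_continuousOn
    (Complex.continuous_im.comp_continuousOn ha)
  refine mul_setLIntegral_le_of_forall_circle hset.measurableSet _
    (((hv.norm.pow 2).div (continuous_norm.pow 2).continuousOn hne).measurable_indicator_ofReal
      hset)
    (ContinuousOn.measurable_indicator_ofReal hset
      ((((continuousOn_const.mul (hdv 1)).add (hre.mul hv)).norm.pow 2).add
        (((continuousOn_const.mul (hdv Complex.I)).add (him.mul hv)).norm.pow 2)))
    fun s hs => ?_
  have hnorm (θ : ℝ) : ‖(s : ℂ) * Complex.exp (θ * Complex.I)‖ = s := by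
    simp [Complex.norm_exp_ofReal_mul_I, abs_of_pos hs]
  by_cases hsΩ : R₁ < s ∧ ENNReal.ofReal s < R₂
  · have hmem (θ : ℝ) : (s : ℂ) * Complex.exp (θ * Complex.I) ∈ Ω := by
      simpa only [hΩ, Set.mem_ofPred_eq, hnorm] using hsΩ
    simp only [Set.indicator_of_mem (hmem _)]
    refine integral_circle_magnetic_hardy hset hs hmem (fun k => ?_) ha hv_smooth
      (ha_circ s hsΩ.1 hsΩ.2) ha_anti hv_symm
    exact ciInf_le ⟨0, by rintro _ ⟨k, rfl⟩; positivity⟩ k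
  · have hmem (θ : ℝ) : (s : ℂ) * Complex.exp (θ * Complex.I) ∉ Ω := by
      simpa only [hΩ, Set.mem_ofPred_eq, hnorm] using hsΩ
    simp only [Set.indicator_of_notMem (hmem _), lintegral_zero, mul_zero, le_refl]

end
end

section
/- Let 0 ≤ R₁ < R₂ ≤ ∞ and let Ω := {r ∈ ℝ² : R₁ < |r| < R₂} be the corresponding annular domain. Let a : Ω → ℝ² be a smooth vector field with vanishing curl on Ω (∂₁a₂ − ∂₂a₁ = 0), whose circulation along every circle of radius s ∈ (R₁,R₂) centered at 0 equals a fixed number Φ ∈ ℝ (i.e. ∫₀^{2π} a(s cos θ, s sin θ)·(−sin θ, cos θ) s dθ = Φ for all s ∈ (R₁,R₂)), and which is antipodal-antisymmetric: a(−r) = −a(r) for all r ∈ Ω. Let v : Ω → ℂ be smooth and antipodal-antisymmetric: v(−r) = −v(r) for all r ∈ Ω. Then ∫_Ω |(−i∇ + a)v|² dr ≥ (min_{k ∈ ℤ} |Φ/(2π) − (2k+1)|²) ∫_Ω |v(r)|²/|r|² dr, where both sides are interpreted as integrals with values in [0,∞]. -/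
open MeasureTheory ENNReal

noncomputable section

/-- On the interval `[x, y]` of length `T = y - x`, the operator `-i d/dθ + c` with periodic
boundary condition has Fourier symbol `2πn/T + c`; a lower bound on the squared symbol yields a
lower bound for its quadratic form. -/
lemma mul_integral_sq_le_of_periodic {w w' : ℝ → ℂ} {x y c μ : ℝ} (hxy : x < y)
    (hw : ∀ θ, HasDerivAt w (w' θ) θ) (hw' : Continuous w') (hper : w y = w x)
    (hμ : ∀ n : ℤ, μ ≤ (2 * Real.pi * n / (y - x) + c) ^ 2) :
    μ * ∫ θ in x..y, ‖w θ‖ ^ 2 ≤ ∫ θ in x..y, ‖-Complex.I * w' θ + c * w θ‖ ^ 2 := by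
  have hwc : Continuous w := continuous_iff_continuousAt.2 fun θ => (hw θ).continuousAt
  have hT : 0 < y - x := sub_pos.2 hxy
  have hTC : (y : ℂ) - x ≠ 0 := by exact_mod_cast hT.ne'
  set u : ℝ → ℂ := fun θ => -Complex.I * w' θ + c * w θ with hu
  have huc : Continuous u := by fun_prop
  have memLp : ∀ {f : ℝ → ℂ}, Continuous f → MemLp f 2 (volume.restrict (Set.Ioc x y)) := by
    intro f hf
    rw [memLp_two_iff_integrable_sq_norm hf.aestronglyMeasurable]
    exact (intervalIntegrable_iff_integrableOn_Ioc_of_le hxy.le).1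
      ((hf.norm.pow 2).intervalIntegrable _ _)
  have deriv_coeff : ∀ n : ℤ, fourierCoeffOn hxy w' n =
      (2 * Real.pi * Complex.I * n / (y - x)) * fourierCoeffOn hxy w n := by
    intro n
    rcases eq_or_ne n 0 with rfl | hn
    · rw [fourierCoeffOn_eq_integral]
      have : ∫ θ in x..y, w' θ = w y - w x :=
        intervalIntegral.integral_eq_sub_of_hasDerivAt (fun θ _ => hw θ)
          (hw'.intervalIntegrable _ _)
      simp [this, hper]
    · rw [fourierCoeffOn_of_hasDerivAt hxy hn (fun θ _ => hw θ) (hw'.intervalIntegrable _ _), hper]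
      have hn' : (n : ℂ) ≠ 0 := by exact_mod_cast hn
      have hpi : (Real.pi : ℂ) ≠ 0 := by exact_mod_cast Real.pi_ne_zero
      have := Complex.I_ne_zero
      field_simp
      ring
  have coeff : ∀ n : ℤ, fourierCoeffOn hxy u n =
      ((2 * Real.pi * n / (y - x) + c : ℝ) : ℂ) * fourierCoeffOn hxy w n := by
    intro n
    have h : fourierCoeffOn hxy u n =
        -Complex.I * fourierCoeffOn hxy w' n + c * fourierCoeffOn hxy w n := by
      simp only [fourierCoeffOn_eq_integral, hu, smul_eq_mul, Complex.real_smul, mul_add]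
      have hf : Continuous fun θ : ℝ => fourier (-n) (θ : AddCircle (y - x)) :=
        (map_continuous _).comp (AddCircle.continuous_mk' _)
      rw [intervalIntegral.integral_add
        (Continuous.intervalIntegrable (by fun_prop) _ _)
        (Continuous.intervalIntegrable (by fun_prop) _ _)]
      simp only [mul_left_comm _ (-Complex.I), mul_left_comm _ (c : ℂ),
        intervalIntegral.integral_const_mul]
      ring
    rw [h, deriv_coeff]
    push_cast
    linear_combination (-(2 * Real.pi * n / (y - x)) * fourierCoeffOn hxy w n) * Complex.I_mul_I
  have hsw := hasSum_sq_fourierCoeffOn hxy (memLp hwc)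
  have hsu := hasSum_sq_fourierCoeffOn hxy (memLp huc)
  have key := hasSum_le (fun n => ?_) (hsw.mul_left μ) hsu
  · simp only [smul_eq_mul] at key
    rw [mul_left_comm] at key
    exact le_of_mul_le_mul_left key (inv_pos.2 hT)
  · rw [coeff, norm_mul, mul_pow, Complex.norm_real, Real.norm_eq_abs, sq_abs]
    exact mul_le_mul_of_nonneg_right (hμ n) (sq_nonneg _)

/-- Magnetic Poincaré inequality on a half circle for antiperiodic functions. -/
lemma mul_integral_sq_le_of_antiperiodic {g g' : ℝ → ℂ} {b : ℝ → ℝ} {x Φ μ : ℝ}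
    (hg : ∀ θ, HasDerivAt g (g' θ) θ) (hg' : Continuous g') (hb : Continuous b)
    (hanti : g (x + Real.pi) = -g x) (hcirc : ∫ θ in x..x + Real.pi, b θ = Φ / 2)
    (hμ : ∀ k : ℤ, μ ≤ (Φ / (2 * Real.pi) - (2 * (k : ℝ) + 1)) ^ 2) :
    μ * ∫ θ in x..x + Real.pi, ‖g θ‖ ^ 2 ≤
      ∫ θ in x..x + Real.pi, ‖-Complex.I * g' θ + b θ * g θ‖ ^ 2 := by
  have hgc : Continuous g := continuous_iff_continuousAt.2 fun θ => (hg θ).continuousAt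
  set c : ℝ := Φ / (2 * Real.pi) - 1 with hc
  set p : ℝ → ℝ := fun θ => (∫ t in x..θ, b t) - c * θ with hp
  have hpd : ∀ θ, HasDerivAt p (b θ - c) θ := fun θ => by
    have h := (hb.integral_hasStrictDerivAt x θ).hasDerivAt.sub ((hasDerivAt_id θ).const_mul c)
    rw [mul_one] at h
    exact h
  have hpc : Continuous p := continuous_iff_continuousAt.2 fun θ => (hpd θ).continuousAt
  set e : ℝ → ℂ := fun θ => Complex.exp ((p θ : ℂ) * Complex.I) with he
  have hec : Continuous e := by fun_prop
  have hnorm : ∀ θ, ‖e θ‖ = 1 := fun θ => Complex.norm_exp_ofReal_mul_I _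
  have hed : ∀ θ, HasDerivAt e (e θ * ((b θ - c : ℝ) * Complex.I)) θ := fun θ =>
    ((hpd θ).ofReal_comp.mul_const Complex.I).cexp
  have hπ : c * Real.pi = Φ / 2 - Real.pi := by
    rw [hc]; field_simp [Real.pi_ne_zero]
  have hper : e (x + Real.pi) * g (x + Real.pi) = e x * g x := by
    have h : ((p (x + Real.pi) : ℝ) : ℂ) * Complex.I =
        (p x : ℝ) * Complex.I + Real.pi * Complex.I := by
      rw [← add_mul, ← Complex.ofReal_add]
      congr 2
      simp only [hp, hcirc, intervalIntegral.integral_same]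
      linarith
    simp only [he, h, Complex.exp_add, Complex.exp_pi_mul_I, hanti]
    ring
  have key := mul_integral_sq_le_of_periodic (c := c) (μ := μ)
    (lt_add_of_pos_right x Real.pi_pos)
    (fun θ => (hed θ).mul (hg θ)) (by fun_prop) hper fun n => by
      refine (hμ (-n)).trans_eq ?_
      rw [add_sub_cancel_left, hc]
      field_simp [Real.pi_ne_zero]
      push_cast
      ring
  have h1 : ∀ θ, -Complex.I * (e θ * ((b θ - c : ℝ) * Complex.I) * g θ + e θ * g' θ) +
      c * (e θ * g θ) = e θ * (-Complex.I * g' θ + b θ * g θ) := fun θ => by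
    push_cast
    linear_combination (-(b θ - c) * e θ * g θ) * Complex.I_mul_I
  simp only [Pi.mul_apply, h1, norm_mul, hnorm, one_mul] at key
  exact key

/-- Magnetic Poincaré inequality on the full circle for antiperiodic functions. -/
lemma mul_lintegral_sq_le_of_antiperiodic {g g' : ℝ → ℂ} {b : ℝ → ℝ} {Φ μ : ℝ}
    (hg : ∀ θ, HasDerivAt g (g' θ) θ) (hg' : Continuous g') (hb : Continuous b)
    (hanti : ∀ θ, g (θ + Real.pi) = -g θ) (hper : Function.Periodic b Real.pi)
    (hcirc : ∫ θ in (0 : ℝ)..2 * Real.pi, b θ = Φ) (hμ0 : 0 ≤ μ)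
    (hμ : ∀ k : ℤ, μ ≤ (Φ / (2 * Real.pi) - (2 * (k : ℝ) + 1)) ^ 2) :
    ENNReal.ofReal μ * ∫⁻ θ in Set.Ioo (-Real.pi) Real.pi, ENNReal.ofReal (‖g θ‖ ^ 2) ≤
      ∫⁻ θ in Set.Ioo (-Real.pi) Real.pi,
        ENNReal.ofReal (‖-Complex.I * g' θ + b θ * g θ‖ ^ 2) := by
  have hgc : Continuous g := continuous_iff_continuousAt.2 fun θ => (hg θ).continuousAt
  have hhalf : ∀ x, ∫ θ in x..x + Real.pi, b θ = Φ / 2 := fun x => by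
    have h := intervalIntegral.integral_add_adjacent_intervals
      (hb.intervalIntegrable (μ := volume) 0 Real.pi)
      (hb.intervalIntegrable Real.pi (Real.pi + Real.pi))
    rw [← two_mul, hcirc, two_mul, hper.intervalIntegral_add_eq Real.pi 0, zero_add] at h
    rw [hper.intervalIntegral_add_eq x 0, zero_add]
    linarith
  have lintegral_eq : ∀ {f : ℝ → ℝ}, Continuous f → (∀ θ, 0 ≤ f θ) →
      ∫⁻ θ in Set.Ioo (-Real.pi) Real.pi, ENNReal.ofReal (f θ) =
        ENNReal.ofReal (∫ θ in (-Real.pi)..Real.pi, f θ) := by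
    intro f hf hf0
    have hle : -Real.pi ≤ Real.pi := by linarith [Real.pi_pos]
    rw [setLIntegral_congr Ioo_ae_eq_Ioc, intervalIntegral.integral_of_le hle,
      ofReal_integral_eq_lintegral_ofReal
        ((intervalIntegrable_iff_integrableOn_Ioc_of_le hle).1 (hf.intervalIntegrable _ _))
        (Filter.Eventually.of_forall hf0)]
  rw [lintegral_eq (by fun_prop) fun θ => sq_nonneg _,
    lintegral_eq (by fun_prop) fun θ => sq_nonneg _, ← ENNReal.ofReal_mul hμ0]
  refine ENNReal.ofReal_le_ofReal ?_
  have h1 := mul_integral_sq_le_of_antiperiodic hg hg' hb (hanti _) (hhalf (-Real.pi)) hμ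
  have h2 := mul_integral_sq_le_of_antiperiodic hg hg' hb (hanti _) (hhalf 0) hμ
  rw [neg_add_cancel] at h1
  rw [zero_add] at h2
  have split : ∀ {f : ℝ → ℝ}, Continuous f → ∫ θ in (-Real.pi)..Real.pi, f θ =
      (∫ θ in (-Real.pi)..0, f θ) + ∫ θ in (0 : ℝ)..Real.pi, f θ := fun hf =>
    (intervalIntegral.integral_add_adjacent_intervals
      (hf.intervalIntegrable _ _) (hf.intervalIntegrable _ _)).symm
  rw [split (by fun_prop), split (by fun_prop), mul_add]
  exact add_le_add h1 h2

/-- Comparison of planar integrals from comparison on every circle around the origin. -/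
lemma lintegral_le_of_forall_circle_le {f h : ℂ → ℝ≥0∞} (hf : Measurable f) (hh : Measurable h)
    (hle : ∀ s : ℝ, 0 < s →
      ∫⁻ θ in Set.Ioo (-Real.pi) Real.pi, f (s * Complex.exp (θ * Complex.I)) ≤
        ∫⁻ θ in Set.Ioo (-Real.pi) Real.pi, h (s * Complex.exp (θ * Complex.I))) :
    ∫⁻ z, f z ≤ ∫⁻ z, h z := by
  have polar : ∀ {F : ℂ → ℝ≥0∞}, Measurable F → ∫⁻ z, F z = ∫⁻ s in Set.Ioi (0 : ℝ),
      ENNReal.ofReal s * ∫⁻ θ in Set.Ioo (-Real.pi) Real.pi,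
        F (s * Complex.exp (θ * Complex.I)) := by
    intro F hF
    have hm : Measurable fun q : ℝ × ℝ => F (q.1 * Complex.exp (q.2 * Complex.I)) :=
      hF.comp (by fun_prop)
    rw [← Complex.lintegral_comp_polarCoord_symm F, polarCoord_target,
      Measure.volume_eq_prod, ← Measure.prod_restrict]
    simp only [Complex.polarCoord_symm_apply, smul_eq_mul, Complex.ofReal_cos, Complex.ofReal_sin,
      ← Complex.exp_mul_I]
    refine (lintegral_prod _
      ((ENNReal.measurable_ofReal.comp measurable_fst).mul hm).aemeasurable).trans ?_
    refine lintegral_congr fun s => ?_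
    have hms : Measurable fun θ : ℝ => F (s * Complex.exp (θ * Complex.I)) :=
      hF.comp (by fun_prop)
    exact lintegral_const_mul (ENNReal.ofReal s) hms
  rw [polar hf, polar hh]
  exact setLIntegral_mono' measurableSet_Ioi fun s hs => mul_le_mul_right (hle s hs) _

/-- The modulus of the tangential component of the magnetic gradient is at most that of the full
magnetic gradient. -/
lemma tangential_sq_le (L : ℂ →L[ℝ] ℂ) (α w t : ℂ) :
    ‖-Complex.I * L t + ((α * starRingEnd ℂ t).re : ℂ) * w‖ ^ 2 ≤
      ‖t‖ ^ 2 * (‖-Complex.I * L 1 + (α.re : ℂ) * w‖ ^ 2 +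
        ‖-Complex.I * L Complex.I + (α.im : ℂ) * w‖ ^ 2) := by
  have hL : L t = t.re * L 1 + t.im * L Complex.I := by
    conv_lhs => rw [show t = t.re • (1 : ℂ) + t.im • Complex.I by
      simp [Complex.re_add_im]]
    rw [map_add, map_smul, map_smul, Complex.real_smul, Complex.real_smul]
  set P := -Complex.I * L 1 + (α.re : ℂ) * w
  set Q := -Complex.I * L Complex.I + (α.im : ℂ) * w
  have hPQ : -Complex.I * L t + ((α * starRingEnd ℂ t).re : ℂ) * w = t.re * P + t.im * Q := by
    rw [hL]
    simp only [P, Q, Complex.mul_re, Complex.conj_re, Complex.conj_im]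
    push_cast
    ring
  rw [hPQ, Complex.sq_norm, Complex.sq_norm, Complex.sq_norm, Complex.sq_norm]
  simp only [Complex.normSq_apply, Complex.add_re, Complex.add_im, Complex.re_ofReal_mul,
    Complex.im_ofReal_mul]
  nlinarith [sq_nonneg (t.re * Q.re - t.im * P.re), sq_nonneg (t.re * Q.im - t.im * P.im)]

/-- **Lemma (magnetic Hardy inequality with antipodal symmetry, antisymmetric case).**
On the annulus `Ω = {R₁ < |r| < R₂}` (with `R₂ ∈ (R₁,∞]`), for a smooth curl-free
vector field `a` (identified with a complex-valued function, components `re`/`im`)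
with constant circulation `Φ` around the inner disk which is antipodal-antisymmetric,
and a smooth antipodal-antisymmetric function `v`, one has
`∫_Ω |(-i∇ + a)v|² ≥ (min_{k ∈ ℤ} |Φ/2π - (2k+1)|²) ∫_Ω |v|²/|r|²`,
both sides interpreted as integrals with values in `[0,∞]`. -/
theorem magnetic_hardy_antisymmetric
    (R₁ : ℝ) (R₂ : ℝ≥0∞) (hR₁ : 0 ≤ R₁) (hR₁₂ : ENNReal.ofReal R₁ < R₂)
    (Ω : Set ℂ) (hΩ : Ω = {r : ℂ | R₁ < ‖r‖ ∧ ENNReal.ofReal ‖r‖ < R₂})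
    (Φ : ℝ) (a : ℂ → ℂ)
    (ha_smooth : ContDiffOn ℝ (⊤ : ℕ∞) a Ω)
    (ha_curl : ∀ r ∈ Ω,
      fderiv ℝ (fun z => (a z).im) r 1 - fderiv ℝ (fun z => (a z).re) r Complex.I = 0)
    (ha_circ : ∀ s : ℝ, R₁ < s → ENNReal.ofReal s < R₂ →
      (∫ θ in (0:ℝ)..(2 * Real.pi),
        (a ((s : ℂ) * Complex.exp ((θ : ℂ) * Complex.I)) *
          starRingEnd ℂ (Complex.I * Complex.exp ((θ : ℂ) * Complex.I))).re * s) = Φ)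
    (ha_anti : ∀ r ∈ Ω, a (-r) = -a r)
    (v : ℂ → ℂ)
    (hv_smooth : ContDiffOn ℝ (⊤ : ℕ∞) v Ω)
    (hv_anti : ∀ r ∈ Ω, v (-r) = -v r) :
    ENNReal.ofReal (⨅ k : ℤ, |Φ / (2 * Real.pi) - (2 * (k : ℝ) + 1)| ^ 2) *
        ∫⁻ r in Ω, ENNReal.ofReal (‖v r‖ ^ 2 / ‖r‖ ^ 2) ≤
      ∫⁻ r in Ω, ENNReal.ofReal
        (‖-Complex.I * fderiv ℝ v r 1 + ((a r).re : ℂ) * v r‖ ^ 2 +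
         ‖-Complex.I * fderiv ℝ v r Complex.I + ((a r).im : ℂ) * v r‖ ^ 2) := by
  classical
  set μ : ℝ := ⨅ k : ℤ, |Φ / (2 * Real.pi) - (2 * (k : ℝ) + 1)| ^ 2
  have hμ0 : 0 ≤ μ := Real.iInf_nonneg fun k => sq_nonneg _
  have hμ : ∀ k : ℤ, μ ≤ (Φ / (2 * Real.pi) - (2 * (k : ℝ) + 1)) ^ 2 := fun k =>
    (ciInf_le ⟨0, by rintro _ ⟨k, rfl⟩; exact sq_nonneg _⟩ k).trans_eq (sq_abs _)
  have hΩo : IsOpen Ω := by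
    rw [hΩ]
    exact (isOpen_lt continuous_const continuous_norm).inter
      (isOpen_lt (ENNReal.continuous_ofReal.comp continuous_norm) continuous_const)
  have hΩ0 : ∀ r ∈ Ω, ‖r‖ ^ 2 ≠ 0 := fun r hr => by
    rw [hΩ] at hr
    exact pow_ne_zero 2 (hR₁.trans_lt hr.1).ne'
  have hvd : ∀ r ∈ Ω, HasFDerivAt v (fderiv ℝ v r) r := fun r hr =>
    ((hv_smooth.contDiffAt (hΩo.mem_nhds hr)).differentiableAt (by simp)).hasFDerivAt
  have hvc : ContinuousOn v Ω := hv_smooth.continuousOn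
  have hac : ContinuousOn a Ω := ha_smooth.continuousOn
  have hdc : ContinuousOn (fderiv ℝ v) Ω :=
    hv_smooth.continuousOn_fderiv_of_isOpen hΩo (by simp)
  set D : ℂ → ℂ := fun r => fderiv ℝ v r (Complex.I * r)
  set β : ℂ → ℝ := fun r => (a r * starRingEnd ℂ (Complex.I * r)).re
  have hDc : ContinuousOn D Ω := hdc.clm_apply (by fun_prop)
  have hβc : ContinuousOn β Ω := Complex.continuous_re.comp_continuousOn
    (hac.mul (Complex.continuous_conj.comp_continuousOn (by fun_prop)))
  set F : ℂ → ℝ≥0∞ := fun r => ENNReal.ofReal (‖v r‖ ^ 2 / ‖r‖ ^ 2)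
  set G : ℂ → ℝ≥0∞ := fun r =>
    ENNReal.ofReal (‖-Complex.I * D r + β r * v r‖ ^ 2 / ‖r‖ ^ 2)
  have measurable_indicator : ∀ {f : ℂ → ℝ≥0∞}, ContinuousOn f Ω → Measurable (Ω.indicator f) := by
    intro f hf
    rw [← Set.piecewise_eq_indicator]
    exact hf.measurable_piecewise continuousOn_const hΩo.measurableSet
  have hF : Measurable (Ω.indicator F) := measurable_indicator <|
    ENNReal.continuous_ofReal.comp_continuousOn
      ((hvc.norm.pow 2).div (by fun_prop) hΩ0)
  have hG : Measurable (Ω.indicator G) := measurable_indicator <|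
    ENNReal.continuous_ofReal.comp_continuousOn
      (((((continuousOn_const.mul hDc).add
        ((Complex.continuous_ofReal.comp_continuousOn hβc).mul hvc)).norm.pow 2)).div
        (by fun_prop) hΩ0)
  have hGle : ∫⁻ r in Ω, G r ≤ ∫⁻ r in Ω, ENNReal.ofReal
        (‖-Complex.I * fderiv ℝ v r 1 + ((a r).re : ℂ) * v r‖ ^ 2 +
         ‖-Complex.I * fderiv ℝ v r Complex.I + ((a r).im : ℂ) * v r‖ ^ 2) := by
    refine setLIntegral_mono' hΩo.measurableSet fun r hr => ENNReal.ofReal_le_ofReal ?_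
    rw [div_le_iff₀' ((sq_nonneg _).lt_of_ne' (hΩ0 r hr))]
    have h := tangential_sq_le (fderiv ℝ v r) (a r) (v r) (Complex.I * r)
    rwa [norm_mul Complex.I, Complex.norm_I, one_mul] at h
  refine le_trans ?_ hGle
  rw [← lintegral_indicator hΩo.measurableSet, ← lintegral_indicator hΩo.measurableSet,
    ← lintegral_const_mul _ hF]
  refine lintegral_le_of_forall_circle_le (hF.const_mul _) hG fun s hs => ?_
  set γ : ℝ → ℂ := fun θ => s * Complex.exp (θ * Complex.I) with hγ
  have hγn : ∀ θ, ‖γ θ‖ = s := fun θ => by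
    simp [hγ, Complex.norm_exp_ofReal_mul_I, abs_of_pos hs]
  by_cases hsΩ : R₁ < s ∧ ENNReal.ofReal s < R₂
  · have hmem : ∀ θ, γ θ ∈ Ω := fun θ => by
      rw [hΩ, Set.mem_ofPred_eq, hγn]
      exact hsΩ
    have hγc : Continuous γ := by fun_prop
    have hγd : ∀ θ, HasDerivAt γ (Complex.I * γ θ) θ := fun θ => by
      have h := ((Complex.ofRealCLM.hasDerivAt (x := θ)).mul_const Complex.I).cexp.const_mul (s : ℂ)
      refine h.congr_deriv ?_
      simp only [hγ, Complex.ofRealCLM_apply, Complex.ofReal_one]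
      ring
    have hγπ : ∀ θ, γ (θ + Real.pi) = -γ θ := fun θ => by
      simp [hγ, add_mul, Complex.exp_add]
    have key := mul_lintegral_sq_le_of_antiperiodic (g := fun θ => v (γ θ))
      (g' := fun θ => D (γ θ)) (b := fun θ => β (γ θ)) (Φ := Φ) (μ := μ)
      (fun θ => (hvd _ (hmem θ)).comp_hasDerivAt θ (hγd θ))
      (hDc.comp_continuous hγc hmem) (hβc.comp_continuous hγc hmem)
      (fun θ => by rw [hγπ, hv_anti _ (hmem θ)])
      (fun θ => by simp [β, hγπ, ha_anti _ (hmem θ)])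
      (by
        rw [← ha_circ s hsΩ.1 hsΩ.2]
        refine intervalIntegral.integral_congr fun θ _ => ?_
        simp only [β, hγ, map_mul, Complex.conj_ofReal]
        rw [← Complex.re_mul_ofReal]
        congr 1
        ring)
      hμ0 hμ
    have hs2 : 0 ≤ (s ^ 2)⁻¹ := by positivity
    have ind : ∀ (f : ℂ → ℝ≥0∞) (θ : ℝ),
        Ω.indicator f (s * Complex.exp (θ * Complex.I)) = f (γ θ) :=
      fun f θ => Set.indicator_of_mem (hmem θ) f
    simp only [ind, F, G, hγn, div_eq_mul_inv,
      ENNReal.ofReal_mul' hs2]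
    have hfin : ENNReal.ofReal (s ^ 2)⁻¹ ≠ ∞ := ENNReal.ofReal_ne_top
    simp only [← mul_assoc]
    rw [lintegral_mul_const' _ _ hfin, lintegral_mul_const' _ _ hfin,
      lintegral_const_mul' _ _ ENNReal.ofReal_ne_top]
    exact mul_le_mul_left key _
  · have hmem : ∀ θ, γ θ ∉ Ω := fun θ => by
      rw [hΩ, Set.mem_ofPred_eq, hγn]
      exact hsΩ
    have ind : ∀ θ : ℝ, Ω.indicator F (s * Complex.exp (θ * Complex.I)) = 0 :=
      fun θ => Set.indicator_of_notMem (hmem θ) F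
    simp [ind]

end
end

section
/- Let α ∈ ℝ, let Ω ⊆ ℝ² be an open convex set, and let u be a 2-anyon wave function. Then ∫_{Ω∘Ω} (|D₁u|² + |D₂u|²) dx₁ dx₂ ≥ 2 (min_{k ∈ ℤ} |α − 2k|²) ∫_{Ω∘Ω} |u(x₁,x₂)|²/|x₁ − x₂|² dx₁ dx₂, where Ω∘Ω := {(x₁,x₂) ∈ Ω² : ½|x₁ − x₂| < dist(½(x₁ + x₂), Ωᶜ)}. -/
open MeasureTheory

noncomputable section

/-- Squared magnitude of the covariant derivative `D_j u` at configuration `x`;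
the plane `ℝ²` is identified with `ℂ` (so `a^⊥ = I·a`, and the two components of a
vector field are the real and imaginary parts). -/
def covSq (α : ℝ) {N : ℕ} (u : (Fin N → ℂ) → ℂ) (j : Fin N) (x : Fin N → ℂ) : ℝ :=
  let A : ℂ := (α : ℂ) * ∑ k ∈ Finset.univ.erase j,
    Complex.I * (x j - x k) / ((‖x j - x k‖ : ℂ) ^ 2)
  ‖-Complex.I * fderiv ℝ u x (Pi.single j 1) + (A.re : ℂ) * u x‖ ^ 2 +
    ‖-Complex.I * fderiv ℝ u x (Pi.single j Complex.I) + (A.im : ℂ) * u x‖ ^ 2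

/-- The statistics constant `C_{α,N} = min_{p ∈ {0,…,N-2}} min_{q ∈ ℤ} |(2p+1)α - 2q|`. -/
def statC (α : ℝ) (N : ℕ) : ℝ :=
  ⨅ p : Fin (N - 1), ⨅ q : ℤ, |(2 * ((p : ℕ) : ℝ) + 1) * α - 2 * (q : ℝ)|

/-- `N`-anyon wave function in the magnetic gauge (smooth compactly supported
form-core representative): totally symmetric with support away from the diagonals. -/
structure IsAnyonWF (N : ℕ) (u : (Fin N → ℂ) → ℂ) : Prop where
  smooth : ContDiff ℝ (⊤ : ℕ∞) u
  compactSupport : HasCompactSupport u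
  symmetric : ∀ (σ : Equiv.Perm (Fin N)) (x : Fin N → ℂ), u (x ∘ σ) = u x
  offDiagonal : ∀ x ∈ tsupport u, ∀ j k : Fin N, j ≠ k → x j ≠ x k

/-- One-particle density of an `N`-particle wave function. -/
def density (N : ℕ) (u : (Fin N → ℂ) → ℂ) (y : ℂ) : ℝ :=
  ∑ j : Fin N, ∫ z : {k : Fin N // k ≠ j} → ℂ,
    ‖u (fun k => if h : k = j then y else z ⟨k, h⟩)‖ ^ 2

/-- The set `Ω∘Ω := {(x₁,x₂) ∈ Ω² : ½|x₁-x₂| < dist(½(x₁+x₂), Ωᶜ)}` (the distance to the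
empty complement being `+∞`, via the extended metric infimum distance). -/
def OcO (Ω : Set ℂ) : Set (ℂ × ℂ) :=
  {p | p.1 ∈ Ω ∧ p.2 ∈ Ω ∧
    ENNReal.ofReal (‖p.1 - p.2‖ / 2) < EMetric.infEdist ((p.1 + p.2) / 2) Ωᶜ}

open Complex in
/-- The Fourier coefficients of the derivative of a function with equal endpoint values. -/
theorem fourierCoeffOn_deriv_of_periodic {f f' : ℝ → ℂ} (hf : ∀ t, HasDerivAt f (f' t) t)
    (hf' : Continuous f') (hper : f Real.pi = f 0) (n : ℤ) :
    fourierCoeffOn Real.pi_pos f' n = 2 * I * n * fourierCoeffOn Real.pi_pos f n := by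
  rcases eq_or_ne n 0 with rfl | hn
  · rw [fourierCoeffOn_eq_integral]
    simp [intervalIntegral.integral_eq_sub_of_hasDerivAt (fun t _ => hf t)
      (hf'.intervalIntegrable _ _), hper]
  · rw [fourierCoeffOn_of_hasDerivAt Real.pi_pos hn (fun t _ => hf t)
      (hf'.intervalIntegrable _ _), hper]
    have hπ : (Real.pi : ℂ) ≠ 0 := by exact_mod_cast Real.pi_ne_zero
    have hn' : (n : ℂ) ≠ 0 := by exact_mod_cast hn
    field_simp
    simp

/-- Magnetic Poincaré inequality on the circle of length `π`. -/
theorem integral_normSq_covariant_deriv_ge (α : ℝ) {f f' : ℝ → ℂ}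
    (hf : ∀ t, HasDerivAt f (f' t) t) (hf' : Continuous f') (hper : f Real.pi = f 0) :
    (⨅ k : ℤ, |α - 2 * (k : ℝ)| ^ 2) * ∫ t in (0 : ℝ)..Real.pi, ‖f t‖ ^ 2 ≤
      ∫ t in (0 : ℝ)..Real.pi, ‖f' t + Complex.I * α * f t‖ ^ 2 := by
  have hfc : Continuous f := continuous_iff_continuousAt.2 fun t => (hf t).continuousAt
  have memLp {g : ℝ → ℂ} (hg : Continuous g) :
      MemLp g 2 (volume.restrict (Set.Ioc 0 Real.pi)) := by
    obtain ⟨C, hC⟩ := isCompact_Icc.exists_bound_of_continuousOn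
      (s := Set.Icc 0 Real.pi) hg.continuousOn
    refine MemLp.of_bound hg.aestronglyMeasurable C ?_
    filter_upwards [ae_restrict_mem measurableSet_Ioc] with t ht
    exact hC t (Set.Ioc_subset_Icc_self ht)
  have hgc : Continuous fun t => f' t + Complex.I * α * f t := by fun_prop
  have hs := hasSum_sq_fourierCoeffOn Real.pi_pos (memLp hfc)
  have hs' := hasSum_sq_fourierCoeffOn Real.pi_pos (memLp hgc)
  have hle := hasSum_le (fun n => ?_) (hs.mul_left (⨅ k : ℤ, |α - 2 * (k : ℝ)| ^ 2)) hs'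
  · simp only [smul_eq_mul, sub_zero] at hle
    rw [mul_left_comm] at hle
    exact le_of_mul_le_mul_left hle (inv_pos.2 Real.pi_pos)
  · have hcoeff : fourierCoeffOn Real.pi_pos (fun t => f' t + Complex.I * α * f t) n =
        Complex.I * (α + 2 * n : ℝ) * fourierCoeffOn Real.pi_pos f n := by
      have hadd : fourierCoeffOn Real.pi_pos (fun t => f' t + Complex.I * α * f t) n =
          fourierCoeffOn Real.pi_pos f' n +
            fourierCoeffOn Real.pi_pos (fun t => Complex.I * α * f t) n := by
        have hχ : Continuous fun t : ℝ => fourier (-n) (t : AddCircle (Real.pi - 0)) :=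
          (map_continuous _).comp (AddCircle.continuous_mk' _)
        simp only [fourierCoeffOn_eq_integral, smul_add]
        rw [intervalIntegral.integral_add, smul_add]
        · exact (hχ.smul hf').intervalIntegrable _ _
        · exact (hχ.smul (by fun_prop)).intervalIntegrable _ _
      rw [hadd, fourierCoeffOn.const_mul, fourierCoeffOn_deriv_of_periodic hf hf' hper]
      push_cast
      ring
    rw [hcoeff, norm_mul, norm_mul, Complex.norm_I, one_mul, Complex.norm_real, mul_pow]
    gcongr
    refine (ciInf_le ⟨0, ?_⟩ (-n)).trans (le_of_eq ?_)
    · rintro _ ⟨k, rfl⟩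
      positivity
    · simp

/-- Multiplication of the relative coordinate `x 0 - x 1` by `e`, with the centre of mass fixed. -/
def relMul (e : ℂ) : (Fin 2 → ℂ) →ₗ[ℂ] (Fin 2 → ℂ) :=
  Matrix.toLin' !![(1 + e) / 2, (1 - e) / 2; (1 - e) / 2, (1 + e) / 2]

theorem relMul_apply (e : ℂ) (x : Fin 2 → ℂ) :
    relMul e x = ![(x 0 + x 1) / 2 + e * ((x 0 - x 1) / 2),
      (x 0 + x 1) / 2 - e * ((x 0 - x 1) / 2)] := by
  ext j
  fin_cases j <;> simp [relMul, Matrix.vecHead, Matrix.vecTail] <;> ring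

theorem relMul_sub (e : ℂ) (x : Fin 2 → ℂ) :
    relMul e x 0 - relMul e x 1 = e * (x 0 - x 1) := by
  simp [relMul_apply]
  ring

theorem relMul_add (e : ℂ) (x : Fin 2 → ℂ) :
    relMul e x 0 + relMul e x 1 = x 0 + x 1 := by
  simp [relMul_apply]

theorem relMul_neg (e : ℂ) (x : Fin 2 → ℂ) :
    relMul (-e) x = relMul e x ∘ Equiv.swap 0 1 := by
  ext j
  fin_cases j <;> simp [relMul_apply, sub_eq_add_neg]

theorem measurePreserving_relMul {e : ℂ} (he : ‖e‖ = 1) : MeasurePreserving (relMul e) := by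
  have hdet : LinearMap.det ((relMul e).restrictScalars ℝ) = 1 := by
    rw [LinearMap.det_restrictScalars, relMul, LinearMap.det_toLin', Matrix.det_fin_two_of,
      Algebra.norm_complex_apply]
    have : (1 + e) / 2 * ((1 + e) / 2) - (1 - e) / 2 * ((1 - e) / 2) = e := by ring
    rw [this, Complex.normSq_eq_norm_sq, he, one_pow]
  refine ⟨(relMul e).continuous_of_finiteDimensional.measurable, ?_⟩
  have h := Measure.map_linearMap_addHaar_eq_smul_addHaar (volume : Measure (Fin 2 → ℂ))
    (f := (relMul e).restrictScalars ℝ) (by simp [hdet])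
  simpa [hdet] using h

theorem mem_OcO_iff (Ω : Set ℂ) (x : Fin 2 → ℂ) :
    (x 0, x 1) ∈ OcO Ω ↔
      ENNReal.ofReal (‖x 0 - x 1‖ / 2) < Metric.infEDist ((x 0 + x 1) / 2) Ωᶜ := by
  refine ⟨fun h => h.2.2, fun h => ⟨?_, ?_, h⟩⟩ <;> by_contra hx <;>
  · refine absurd (Metric.infEDist_le_edist_of_mem (s := Ωᶜ) (x := (x 0 + x 1) / 2) hx) (not_le.2 ?_)
    convert h using 1
    rw [edist_dist, dist_eq_norm]
    congr 1
    first
    | rw [show (x 0 + x 1) / 2 - x 0 = -((x 0 - x 1) / 2) by ring, norm_neg]; simp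
    | rw [show (x 0 + x 1) / 2 - x 1 = (x 0 - x 1) / 2 by ring]; simp

theorem measurableSet_OcO (Ω : Set ℂ) :
    MeasurableSet {x : Fin 2 → ℂ | (x 0, x 1) ∈ OcO Ω} := by
  simp only [mem_OcO_iff]
  refine (isOpen_lt ?_ ?_).measurableSet
  · exact ENNReal.continuous_ofReal.comp (by fun_prop)
  · exact Metric.continuous_infEDist.comp (by fun_prop)

theorem relMul_preimage_OcO (Ω : Set ℂ) {e : ℂ} (he : ‖e‖ = 1) :
    relMul e ⁻¹' {x | (x 0, x 1) ∈ OcO Ω} = {x | (x 0, x 1) ∈ OcO Ω} := by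
  ext x
  simp only [Set.mem_preimage, Set.mem_ofPred_eq, mem_OcO_iff]
  rw [relMul_sub, relMul_add, norm_mul, he, one_mul]

theorem continuous_relMul_exp :
    Continuous fun p : (Fin 2 → ℂ) × ℝ => relMul (Complex.exp (p.2 * Complex.I)) p.1 := by
  simp only [relMul_apply]
  refine continuous_pi fun j => ?_
  fin_cases j <;> simp <;> fun_prop

/-- Averaging over rotations of the relative coordinate does not change integrals over `Ω∘Ω`. -/
theorem lintegral_OcO_relMul_average (Ω : Set ℂ) {H : (Fin 2 → ℂ) → ENNReal} (hH : Measurable H) :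
    ∫⁻ x in {x : Fin 2 → ℂ | (x 0, x 1) ∈ OcO Ω}, ∫⁻ t in Set.Ioc (0 : ℝ) Real.pi,
        H (relMul (Complex.exp (t * Complex.I)) x) =
      ENNReal.ofReal Real.pi * ∫⁻ x in {x : Fin 2 → ℂ | (x 0, x 1) ∈ OcO Ω}, H x := by
  rw [lintegral_lintegral_swap]
  · have h (t : ℝ) : ∫⁻ x in {x : Fin 2 → ℂ | (x 0, x 1) ∈ OcO Ω},
        H (relMul (Complex.exp (t * Complex.I)) x) =
        ∫⁻ x in {x : Fin 2 → ℂ | (x 0, x 1) ∈ OcO Ω}, H x := by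
      have he := Complex.norm_exp_ofReal_mul_I t
      have := (measurePreserving_relMul he).setLIntegral_comp_preimage (measurableSet_OcO Ω) hH
      rwa [relMul_preimage_OcO Ω he] at this
    rw [lintegral_congr h]
    simp [mul_comm]
  · exact (hH.comp continuous_relMul_exp.measurable).aemeasurable

theorem sq_norm_combination_le (v w : ℝ) (p q p' q' : ℂ) :
    ‖v * (p - p') + w * (q - q')‖ ^ 2 ≤
      2 * (v ^ 2 + w ^ 2) * (‖p‖ ^ 2 + ‖q‖ ^ 2 + (‖p'‖ ^ 2 + ‖q'‖ ^ 2)) := by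
  have h : ‖v * (p - p') + w * (q - q')‖ ≤ |v| * (‖p‖ + ‖p'‖) + |w| * (‖q‖ + ‖q'‖) := by
    refine (norm_add_le _ _).trans ?_
    rw [norm_mul, norm_mul, Complex.norm_real, Complex.norm_real, Real.norm_eq_abs,
      Real.norm_eq_abs]
    gcongr <;> exact norm_sub_le _ _
  calc _ ≤ (|v| * (‖p‖ + ‖p'‖) + |w| * (‖q‖ + ‖q'‖)) ^ 2 := by gcongr
    _ ≤ (|v| ^ 2 + |w| ^ 2) * ((‖p‖ + ‖p'‖) ^ 2 + (‖q‖ + ‖q'‖) ^ 2) := by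
      nlinarith [sq_nonneg (|v| * (‖q‖ + ‖q'‖) - |w| * (‖p‖ + ‖p'‖))]
    _ ≤ (|v| ^ 2 + |w| ^ 2) * (2 * (‖p‖ ^ 2 + ‖q‖ ^ 2 + (‖p'‖ ^ 2 + ‖q'‖ ^ 2))) := by
      gcongr
      nlinarith [sq_nonneg (‖p‖ - ‖p'‖), sq_nonneg (‖q‖ - ‖q'‖)]
    _ = _ := by rw [sq_abs, sq_abs]; ring

/-- The kinetic energy density dominates its angular part in the relative coordinate. -/
theorem angular_le_covSq_add (α : ℝ) (u : (Fin 2 → ℂ) → ℂ) (x : Fin 2 → ℂ) (hx : x 0 - x 1 ≠ 0) :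
    2 / ‖x 0 - x 1‖ ^ 2 *
        ‖fderiv ℝ u x ![Complex.I * (x 0 - x 1) / 2, -(Complex.I * (x 0 - x 1) / 2)] +
          Complex.I * α * u x‖ ^ 2 ≤
      covSq α u 0 x + covSq α u 1 x := by
  set z : ℂ := x 0 - x 1 with hz
  have hN : ‖z‖ ^ 2 = z.re ^ 2 + z.im ^ 2 := by
    rw [← Complex.normSq_eq_norm_sq, Complex.normSq_apply]; ring
  have hpos : 0 < ‖z‖ ^ 2 := by positivity
  have hL : fderiv ℝ u x ![Complex.I * z / 2, -(Complex.I * z / 2)] =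
      ((-z.im : ℝ) * (fderiv ℝ u x (Pi.single 0 1) - fderiv ℝ u x (Pi.single 1 1)) +
        (z.re : ℝ) * (fderiv ℝ u x (Pi.single 0 Complex.I) -
          fderiv ℝ u x (Pi.single 1 Complex.I))) / 2 := by
    have : (![Complex.I * z / 2, -(Complex.I * z / 2)] : Fin 2 → ℂ) =
        (-z.im / 2) • (Pi.single 0 1 - Pi.single 1 1) +
          (z.re / 2) • (Pi.single 0 Complex.I - Pi.single 1 Complex.I) := by
      ext j
      fin_cases j <;> apply Complex.ext <;> simp [neg_div]
    rw [this, map_add, map_smul, map_smul, map_sub, map_sub]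
    simp only [Complex.real_smul]
    push_cast
    ring
  have e0 : (Finset.univ : Finset (Fin 2)).erase 0 = {1} := by decide
  have e1 : (Finset.univ : Finset (Fin 2)).erase 1 = {0} := by decide
  have hz' : x 1 - x 0 = -z := by rw [hz]; ring
  have hA : (α : ℂ) * (Complex.I * z / (‖z‖ : ℂ) ^ 2) =
      ((-(α * z.im / ‖z‖ ^ 2) : ℝ) : ℂ) + ((α * z.re / ‖z‖ ^ 2 : ℝ) : ℂ) * Complex.I := by
    push_cast
    linear_combination (α * z.im / (‖z‖ : ℂ) ^ 2) * Complex.I_sq -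
      (α * Complex.I / (‖z‖ : ℂ) ^ 2) * Complex.re_add_im z
  have hA' : (α : ℂ) * (Complex.I * -z / (‖z‖ : ℂ) ^ 2) =
      ((α * z.im / ‖z‖ ^ 2 : ℝ) : ℂ) + ((-(α * z.re / ‖z‖ ^ 2) : ℝ) : ℂ) * Complex.I := by
    rw [mul_neg, neg_div, mul_neg, hA]
    push_cast
    ring
  simp only [covSq, e0, e1, Finset.sum_singleton, hz', ← hz, norm_neg]
  rw [hA, hA', hL]
  simp only [Complex.add_re, Complex.add_im, Complex.ofReal_re, Complex.ofReal_im,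
    Complex.mul_re, Complex.mul_im, Complex.I_re, Complex.I_im, mul_zero, mul_one, sub_zero,
    zero_add, add_zero]
  have key := sq_norm_combination_le (-z.im) z.re
    (-Complex.I * fderiv ℝ u x (Pi.single 0 1) + (-(α * z.im / ‖z‖ ^ 2) : ℝ) * u x)
    (-Complex.I * fderiv ℝ u x (Pi.single 0 Complex.I) + (α * z.re / ‖z‖ ^ 2 : ℝ) * u x)
    (-Complex.I * fderiv ℝ u x (Pi.single 1 1) + (α * z.im / ‖z‖ ^ 2 : ℝ) * u x)
    (-Complex.I * fderiv ℝ u x (Pi.single 1 Complex.I) + (-(α * z.re / ‖z‖ ^ 2) : ℝ) * u x)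
  generalize fderiv ℝ u x (Pi.single 0 1) = a at *
  generalize fderiv ℝ u x (Pi.single 0 Complex.I) = b at *
  generalize fderiv ℝ u x (Pi.single 1 1) = c at *
  generalize fderiv ℝ u x (Pi.single 1 Complex.I) = d at *
  rw [neg_sq, add_comm (z.im ^ 2), ← hN] at key
  have hcomb : ((-z.im : ℝ) : ℂ) *
        (-Complex.I * a + (-(α * z.im / ‖z‖ ^ 2) : ℝ) * u x -
          (-Complex.I * c + (α * z.im / ‖z‖ ^ 2 : ℝ) * u x)) +
      (z.re : ℂ) *
        (-Complex.I * b + (α * z.re / ‖z‖ ^ 2 : ℝ) * u x -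
          (-Complex.I * d + (-(α * z.re / ‖z‖ ^ 2) : ℝ) * u x)) =
      -2 * Complex.I * (((-z.im : ℝ) * (a - c) + (z.re : ℝ) * (b - d)) / 2 +
        Complex.I * α * u x) := by
    have hα : (z.im : ℂ) * (α * z.im / (‖z‖ : ℂ) ^ 2) + z.re * (α * z.re / (‖z‖ : ℂ) ^ 2) = α := by
      have hN' : (‖z‖ : ℂ) ^ 2 = (z.re : ℂ) ^ 2 + (z.im : ℂ) ^ 2 := by exact_mod_cast hN
      have hne : (‖z‖ : ℂ) ^ 2 ≠ 0 := by exact_mod_cast hpos.ne'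
      calc _ = (α : ℂ) * (((z.re : ℂ) ^ 2 + (z.im : ℂ) ^ 2) / (‖z‖ : ℂ) ^ 2) := by ring
        _ = α := by rw [← hN', div_self hne, mul_one]
    push_cast
    linear_combination (2 * u x) * hα + (2 * α * u x) * Complex.I_sq
  rw [hcomb, norm_mul, norm_mul, norm_neg, Complex.norm_I, mul_pow, RCLike.norm_ofNat] at key
  rw [div_mul_eq_mul_div, div_le_iff₀ hpos]
  linarith

theorem hasDerivAt_comp_relMul {u : (Fin 2 → ℂ) → ℂ} (hu : Differentiable ℝ u) (x : Fin 2 → ℂ)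
    (t : ℝ) :
    let y := relMul (Complex.exp (t * Complex.I)) x
    HasDerivAt (fun s : ℝ => u (relMul (Complex.exp (s * Complex.I)) x))
      (fderiv ℝ u y ![Complex.I * (y 0 - y 1) / 2, -(Complex.I * (y 0 - y 1) / 2)]) t := by
  intro y
  refine (hu y).hasFDerivAt.comp_hasDerivAt t ?_
  have he : HasDerivAt (fun s : ℝ => Complex.exp (s * Complex.I))
      (Complex.exp (t * Complex.I) * Complex.I) t := by
    simpa using ((hasDerivAt_id t).ofReal_comp.mul_const Complex.I).cexp
  have h := he.mul_const ((x 0 - x 1) / 2)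
  simp only [y, relMul_sub]
  simp only [relMul_apply]
  refine hasDerivAt_pi.2 (Fin.forall_fin_two.2 ⟨?_, ?_⟩)
  · refine (h.const_add ((x 0 + x 1) / 2)).congr_deriv ?_
    change _ = Complex.I * (Complex.exp (t * Complex.I) * (x 0 - x 1)) / 2
    ring
  · refine (h.const_sub ((x 0 + x 1) / 2)).congr_deriv ?_
    change _ = -(Complex.I * (Complex.exp (t * Complex.I) * (x 0 - x 1)) / 2)
    ring

theorem measurable_covSq (α : ℝ) {u : (Fin 2 → ℂ) → ℂ} (hu : ContDiff ℝ (⊤ : ℕ∞) u) (j : Fin 2) :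
    Measurable (covSq α u j) := by
  have hd (v : Fin 2 → ℂ) : Measurable fun x => fderiv ℝ u x v :=
    measurable_fderiv_apply_const ℝ u v
  have hm : Measurable u := hu.continuous.measurable
  have h1 := hd (Pi.single j 1)
  have h2 := hd (Pi.single j Complex.I)
  unfold covSq
  fun_prop

/-- Hardy's inequality on a single orbit of rotations of the relative coordinate. -/
theorem lintegral_orbit_hardy (α : ℝ) {u : (Fin 2 → ℂ) → ℂ} (hu : IsAnyonWF 2 u)
    (x : Fin 2 → ℂ) :
    ENNReal.ofReal (2 * ⨅ k : ℤ, |α - 2 * (k : ℝ)| ^ 2) *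
        ∫⁻ t in Set.Ioc (0 : ℝ) Real.pi,
          (fun y : Fin 2 → ℂ => ENNReal.ofReal (‖u y‖ ^ 2 / ‖y 0 - y 1‖ ^ 2))
            (relMul (Complex.exp (t * Complex.I)) x) ≤
      ∫⁻ t in Set.Ioc (0 : ℝ) Real.pi,
        (fun y : Fin 2 → ℂ => ENNReal.ofReal (covSq α u 0 y + covSq α u 1 y))
          (relMul (Complex.exp (t * Complex.I)) x) := by
  have hnorm (t : ℝ) : ‖relMul (Complex.exp (t * Complex.I)) x 0 -
      relMul (Complex.exp (t * Complex.I)) x 1‖ = ‖x 0 - x 1‖ := by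
    rw [relMul_sub, norm_mul, Complex.norm_exp_ofReal_mul_I, one_mul]
  simp only [hnorm]
  rcases eq_or_ne (x 0 - x 1) 0 with hx | hx
  · simp [hx]
  have hρ : 0 < ‖x 0 - x 1‖ ^ 2 := by positivity
  have hmin : 0 ≤ ⨅ k : ℤ, |α - 2 * (k : ℝ)| ^ 2 := Real.iInf_nonneg fun k => by positivity
  obtain ⟨γ, hγx⟩ : ∃ γ : ℝ → Fin 2 → ℂ, ∀ t : ℝ, relMul (Complex.exp (t * Complex.I)) x = γ t :=
    ⟨_, fun _ => rfl⟩
  simp only [hγx] at hnorm ⊢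
  have hγ : Continuous γ := by
    simpa only [← funext hγx, Function.comp_def] using
      continuous_relMul_exp.comp (Continuous.prodMk_right x)
  have hud : Differentiable ℝ u := hu.smooth.differentiable (by simp)
  let f (t : ℝ) := u (γ t)
  let f' (t : ℝ) := fderiv ℝ u (γ t)
    ![Complex.I * (γ t 0 - γ t 1) / 2, -(Complex.I * (γ t 0 - γ t 1) / 2)]
  have hf (t : ℝ) : HasDerivAt f (f' t) t := by
    simpa only [hγx] using hasDerivAt_comp_relMul hud x t
  have hfc : Continuous f := hud.continuous.comp hγ
  have hf' : Continuous f' := by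
    have hw : Continuous fun t => Complex.I * (γ t 0 - γ t 1) / 2 :=
      (continuous_const.mul (((continuous_apply 0).comp hγ).sub
        ((continuous_apply 1).comp hγ))).div_const 2
    exact ((hu.smooth.continuous_fderiv (by simp)).comp hγ).clm_apply
      (continuous_pi (Fin.forall_fin_two.2 ⟨hw, hw.neg⟩))
  have hper : f Real.pi = f 0 := by
    have : γ Real.pi = γ 0 ∘ Equiv.swap 0 1 := by
      simp only [← hγx, Complex.exp_pi_mul_I, Complex.ofReal_zero, zero_mul, Complex.exp_zero]
      exact relMul_neg 1 x
    exact (congrArg u this).trans (hu.symmetric _ _)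
  have key := integral_normSq_covariant_deriv_ge α hf hf' hper
  have lintegral_eq {g : ℝ → ℝ} (hg : Continuous g) (h0 : ∀ t, 0 ≤ g t) :
      ∫⁻ t in Set.Ioc (0 : ℝ) Real.pi, ENNReal.ofReal (g t) =
        ENNReal.ofReal (∫ t in (0 : ℝ)..Real.pi, g t) := by
    rw [intervalIntegral.integral_of_le Real.pi_pos.le, ofReal_integral_eq_lintegral_ofReal]
    · exact (hg.intervalIntegrable _ _).1
    · exact Filter.Eventually.of_forall h0
  have lower (t : ℝ) : ENNReal.ofReal (2 / ‖x 0 - x 1‖ ^ 2 * ‖f' t + Complex.I * α * f t‖ ^ 2) ≤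
      ENNReal.ofReal (covSq α u 0 (γ t) + covSq α u 1 (γ t)) := by
    refine ENNReal.ofReal_le_ofReal ?_
    have h := angular_le_covSq_add α u (γ t) (by rw [← norm_ne_zero_iff, hnorm]; simpa using hx)
    rwa [hnorm] at h
  refine le_trans ?_ (lintegral_mono lower)
  rw [lintegral_eq (g := fun t => ‖f t‖ ^ 2 / ‖x 0 - x 1‖ ^ 2) (by fun_prop) fun t => by positivity,
    lintegral_eq (by fun_prop) fun t => by positivity,
    ← ENNReal.ofReal_mul (by positivity), intervalIntegral.integral_div,
    intervalIntegral.integral_const_mul]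
  refine ENNReal.ofReal_le_ofReal ?_
  calc _ = 2 / ‖x 0 - x 1‖ ^ 2 * ((⨅ k : ℤ, |α - 2 * (k : ℝ)| ^ 2) *
        ∫ t in (0 : ℝ)..Real.pi, ‖f t‖ ^ 2) := by ring
    _ ≤ _ := by gcongr

/-- **Lemma (relative two-anyon Hardy inequality).** For an open convex `Ω ⊆ ℝ²` and a
two-anyon wave function `u`,
`∫_{Ω∘Ω} (|D₁u|² + |D₂u|²) ≥ 2 (min_{k∈ℤ} |α-2k|²) ∫_{Ω∘Ω} |u|²/|x₁-x₂|²`. -/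
theorem two_anyon_hardy (α : ℝ) (Ω : Set ℂ) (hΩopen : IsOpen Ω) (hΩconv : Convex ℝ Ω)
    (u : (Fin 2 → ℂ) → ℂ) (hu : IsAnyonWF 2 u) :
    ENNReal.ofReal (2 * ⨅ k : ℤ, |α - 2 * (k : ℝ)| ^ 2) *
        ∫⁻ x in {x : Fin 2 → ℂ | (x 0, x 1) ∈ OcO Ω},
          ENNReal.ofReal (‖u x‖ ^ 2 / ‖x 0 - x 1‖ ^ 2) ≤
      ∫⁻ x in {x : Fin 2 → ℂ | (x 0, x 1) ∈ OcO Ω},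
        ENNReal.ofReal (covSq α u 0 x + covSq α u 1 x) := by
  have hG : Measurable fun x : Fin 2 → ℂ => ENNReal.ofReal (‖u x‖ ^ 2 / ‖x 0 - x 1‖ ^ 2) := by
    have hm : Measurable u := hu.smooth.continuous.measurable
    fun_prop
  have hF : Measurable fun x : Fin 2 → ℂ => ENNReal.ofReal (covSq α u 0 x + covSq α u 1 x) :=
    ((measurable_covSq α hu.smooth 0).add (measurable_covSq α hu.smooth 1)).ennreal_ofReal
  have hπ : ENNReal.ofReal Real.pi ≠ 0 := by simpa using Real.pi_pos
  rw [← ENNReal.mul_le_mul_iff_right hπ ENNReal.ofReal_ne_top, mul_left_comm,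
    ← lintegral_OcO_relMul_average Ω hG, ← lintegral_OcO_relMul_average Ω hF,
    ← lintegral_const_mul' _ _ ENNReal.ofReal_ne_top]
  exact lintegral_mono fun x => lintegral_orbit_hardy α hu x

end
end

section
/- Let α ∈ ℝ, N ≥ 2, let Ω ⊆ ℝ² be an open convex set, and let u be an N-anyon wave function. Then ∫_{Ω^N} ∑_{j=1}^N |D_j u|² dx ≥ (4 C_{α,N}²/N) ∫_{Ω^N} ∑_{1≤i<j≤N} (|u|²/|x_i − x_j|²) χ_{Ω∘Ω}(x_i,x_j) dx, where Ω∘Ω := {(x,y) ∈ Ω² : ½|x − y| < dist(½(x + y), Ωᶜ)} and χ_{Ω∘Ω} is its characteristic function. -/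
open MeasureTheory

noncomputable section

theorem fourierCoeffOn_deriv_of_periodic_s5 {g g' : ℝ → ℂ}
    (hg : ∀ x, HasDerivAt g (g' x) x) (hg' : Continuous g') (hper : g Real.pi = g 0) (n : ℤ) :
    fourierCoeffOn Real.pi_pos g' n = 2 * n * Complex.I * fourierCoeffOn Real.pi_pos g n := by
  have hπ : (Real.pi : ℂ) ≠ 0 := by exact_mod_cast Real.pi_ne_zero
  rcases eq_or_ne n 0 with rfl | hn
  · rw [fourierCoeffOn_eq_integral]
    simp [intervalIntegral.integral_eq_sub_of_hasDerivAt (fun x _ => hg x)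
      (hg'.intervalIntegrable _ _), hper]
  · rw [fourierCoeffOn_of_hasDerivAt Real.pi_pos hn (fun x _ => hg x)
      (hg'.intervalIntegrable _ _), hper]
    have hn' : (n : ℂ) ≠ 0 := by exact_mod_cast hn
    field_simp
    simp

theorem sq_mul_integral_le_of_periodic {g g' : ℝ → ℂ}
    (hg : ∀ x, HasDerivAt g (g' x) x) (hg' : Continuous g') (hper : g Real.pi = g 0)
    {β C : ℝ} (hC₀ : 0 ≤ C) (hC : ∀ n : ℤ, C ≤ |2 * n + β|) :
    C ^ 2 * ∫ x in (0 : ℝ)..Real.pi, ‖g x‖ ^ 2 ≤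
      ∫ x in (0 : ℝ)..Real.pi, ‖-Complex.I * g' x + β * g x‖ ^ 2 := by
  have hgc : Continuous g := continuous_iff_continuousAt.2 fun x => (hg x).continuousAt
  have memLp {f : ℝ → ℂ} (hf : Continuous f) :
      MemLp f 2 (volume.restrict (Set.Ioc 0 Real.pi)) := by
    obtain ⟨K, hK⟩ := isCompact_Icc.exists_bound_of_continuousOn
      (s := Set.Icc 0 Real.pi) hf.continuousOn
    exact MemLp.of_bound hf.aestronglyMeasurable K
      ((ae_restrict_mem measurableSet_Ioc).mono fun x hx => hK x (Set.Ioc_subset_Icc_self hx))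
  have hD : Continuous fun x => -Complex.I * g' x + β * g x := by fun_prop
  have h1 := (hasSum_sq_fourierCoeffOn Real.pi_pos (memLp hgc)).mul_left (C ^ 2)
  have h2 := hasSum_sq_fourierCoeffOn Real.pi_pos (memLp hD)
  have hcoeff (n : ℤ) : fourierCoeffOn Real.pi_pos (fun x => -Complex.I * g' x + β * g x) n =
      ((2 * n + β : ℝ) : ℂ) * fourierCoeffOn Real.pi_pos g n := by
    have hadd : fourierCoeffOn Real.pi_pos (fun x => -Complex.I * g' x + β * g x) n =
        -Complex.I * fourierCoeffOn Real.pi_pos g' n + β * fourierCoeffOn Real.pi_pos g n := by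
      rw [← fourierCoeffOn.const_mul, ← fourierCoeffOn.const_mul]
      simp only [fourierCoeffOn_eq_integral]
      rw [← smul_add, ← intervalIntegral.integral_add]
      · simp only [smul_eq_mul, mul_add]
      all_goals
        refine Continuous.intervalIntegrable ?_ _ _
        simp only [fourier_coe_apply]
        fun_prop
    rw [hadd, fourierCoeffOn_deriv_of_periodic_s5 hg hg' hper]
    push_cast
    linear_combination (-2 * n * fourierCoeffOn Real.pi_pos g n) * Complex.I_sq
  have h := hasSum_le (fun n => ?_) h1 h2
  · simp only [sub_zero, smul_eq_mul] at h
    have hπ := Real.pi_pos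
    rw [mul_left_comm] at h
    exact le_of_mul_le_mul_left h (by positivity)
  · rw [hcoeff, norm_mul, mul_pow, Complex.norm_real, Real.norm_eq_abs]
    have := hC n
    gcongr

theorem sq_mul_integral_le_integral_covDeriv {f f' : ℝ → ℂ} {a : ℝ → ℝ}
    (hf : ∀ x, HasDerivAt f (f' x) x) (hf' : Continuous f') (hper : f Real.pi = f 0)
    (ha : Continuous a) {β C : ℝ} (hflux : ∫ x in (0 : ℝ)..Real.pi, a x = Real.pi * β)
    (hC₀ : 0 ≤ C) (hC : ∀ n : ℤ, C ≤ |2 * n + β|) :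
    C ^ 2 * ∫ x in (0 : ℝ)..Real.pi, ‖f x‖ ^ 2 ≤
      ∫ x in (0 : ℝ)..Real.pi, ‖-Complex.I * f' x + a x * f x‖ ^ 2 := by
  set Φ : ℝ → ℝ := fun t => (∫ x in (0 : ℝ)..t, a x) - β * t with hΦ_def
  have hΦ (t : ℝ) : HasDerivAt Φ (a t - β) t := by
    simpa using (ha.integral_hasStrictDerivAt 0 t).hasDerivAt.fun_sub
      ((hasDerivAt_id' t).const_mul β)
  have hΦ0 : Φ 0 = 0 := by simp [Φ]
  have hΦπ : Φ Real.pi = 0 := by simp only [Φ, hflux]; ring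
  have hΦc : Continuous Φ := continuous_iff_continuousAt.2 fun x => (hΦ x).continuousAt
  have hfc : Continuous f := continuous_iff_continuousAt.2 fun x => (hf x).continuousAt
  have hnorm (t : ℝ) : ‖Complex.exp (Φ t * Complex.I)‖ = 1 := Complex.norm_exp_ofReal_mul_I _
  have key := sq_mul_integral_le_of_periodic (g := fun t => Complex.exp (Φ t * Complex.I) * f t)
    (g' := fun t => Complex.exp (Φ t * Complex.I) * ((a t - β : ℝ) * Complex.I) * f t +
      Complex.exp (Φ t * Complex.I) * f' t)
    (fun t => (((hΦ t).ofReal_comp.mul_const Complex.I).cexp.mul (hf t)))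
    (by fun_prop) (by simp [hΦ0, hΦπ, hper]) hC₀ hC
  have hgauge (t : ℝ) : -Complex.I * (Complex.exp (Φ t * Complex.I) *
      ((a t - β : ℝ) * Complex.I) * f t + Complex.exp (Φ t * Complex.I) * f' t) +
      β * (Complex.exp (Φ t * Complex.I) * f t) =
      Complex.exp (Φ t * Complex.I) * (-Complex.I * f' t + a t * f t) := by
    push_cast
    linear_combination (-(Complex.exp (Φ t * Complex.I)) * (a t - β) * f t) * Complex.I_sq
  simpa only [hgauge, norm_mul, hnorm, one_mul] using key

theorem circleIntegral_sub_inv_of_lt {w : ℂ} {R : ℝ} (hR : 0 ≤ R) (hw : R < ‖w‖) :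
    (∮ z in C(0, R), (z - w)⁻¹) = 0 := by
  have hne (z : ℂ) (hz : z ∈ Metric.closedBall (0 : ℂ) R) : z - w ≠ 0 := by
    rintro h
    rw [sub_eq_zero.1 h, mem_closedBall_zero_iff] at hz
    linarith
  refine Complex.circleIntegral_eq_zero_of_differentiable_on_off_countable hR
    Set.countable_empty (ContinuousOn.inv₀ (by fun_prop) hne) fun z hz => ?_
  exact (by fun_prop : DifferentiableAt ℂ (fun z => z - w) z).inv
    (hne z (Metric.ball_subset_closedBall hz.1))

theorem integral_div_sub_of_norm_ne {z w : ℂ} (hzw : ‖w‖ ≠ ‖z‖) :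
    ∫ t in (0 : ℝ)..Real.pi, z * Complex.exp (t * Complex.I) ^ 2 /
      (z * Complex.exp (t * Complex.I) ^ 2 - w) =
      if ‖w‖ < ‖z‖ then (Real.pi : ℂ) else 0 := by
  obtain ⟨v, hv⟩ : ∃ v : ℂ, ‖v‖ = 1 ∧ z = ‖z‖ * v := by
    refine ⟨Complex.exp (z.arg * Complex.I), Complex.norm_exp_ofReal_mul_I _, ?_⟩
    exact (Complex.norm_mul_exp_arg_mul_I z).symm
  have hv0 : v ≠ 0 := norm_ne_zero_iff.1 (by rw [hv.1]; exact one_ne_zero)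
  have hw : ‖w / v‖ = ‖w‖ := by rw [norm_div, hv.1, div_one]
  have hcirc : (∮ ζ in C(0, ‖z‖), (ζ - w / v)⁻¹) =
      if ‖w‖ < ‖z‖ then 2 * Real.pi * Complex.I else 0 := by
    split_ifs with h
    · exact circleIntegral.integral_sub_inv_of_mem_ball (by simpa [hv.1] using h)
    · exact circleIntegral_sub_inv_of_lt (norm_nonneg z)
        (hw.symm ▸ lt_of_le_of_ne (not_lt.1 h) hzw.symm)
  have hint (t : ℝ) : z * Complex.exp (t * Complex.I) ^ 2 /
      (z * Complex.exp (t * Complex.I) ^ 2 - w) = -Complex.I *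
      (fun θ : ℝ => deriv (circleMap 0 ‖z‖) θ • (circleMap 0 ‖z‖ θ - w / v)⁻¹) (2 * t) := by
    have h1 : circleMap 0 ‖z‖ (2 * t) = z * Complex.exp (t * Complex.I) ^ 2 / v := by
      rw [circleMap_zero, ← Complex.exp_nat_mul, eq_div_iff hv0]
      conv_rhs => rw [hv.2]
      push_cast
      ring_nf
    simp only [deriv_circleMap, smul_eq_mul, h1]
    rw [← sub_div, inv_div]
    field_simp
    linear_combination (z /
      (z * Complex.exp (t * Complex.I) ^ 2 - w)) * Complex.I_sq
  simp only [hint]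
  rw [intervalIntegral.integral_const_mul,
    intervalIntegral.integral_comp_mul_left (fun θ : ℝ =>
      deriv (circleMap 0 ‖z‖) θ • (circleMap 0 ‖z‖ θ - w / v)⁻¹) two_ne_zero, mul_zero]
  change -Complex.I * ((2 : ℝ)⁻¹ • ∮ ζ in C(0, ‖z‖), (ζ - w / v)⁻¹) = _
  rw [hcirc, mul_smul_comm]
  split_ifs
  · rw [Complex.real_smul]
    push_cast
    linear_combination (-Real.pi : ℂ) * Complex.I_sq
  · simp

/-- The rotation by the angle `t` of the particles `i` and `j` about their midpoint. -/
def pairRot {N : ℕ} (i j : Fin N) (t : ℝ) : (Fin N → ℂ) →ₗ[ℝ] (Fin N → ℂ) where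
  toFun x := x + ((Complex.exp (t * Complex.I) - 1) / 2 * (x i - x j)) •
    (Pi.single i 1 - Pi.single j 1)
  map_add' x y := by
    ext k
    simp only [Pi.add_apply, Pi.smul_apply, smul_eq_mul]
    ring
  map_smul' c x := by
    ext k
    simp only [Pi.add_apply, Pi.smul_apply, smul_eq_mul, RingHom.id_apply, Complex.real_smul]
    ring

section pairRot

variable {N : ℕ} {i j : Fin N}

theorem pairRot_apply (i j : Fin N) (t : ℝ) (x : Fin N → ℂ) :
    pairRot i j t x = x + ((Complex.exp (t * Complex.I) - 1) / 2 * (x i - x j)) •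
      (Pi.single i 1 - Pi.single j 1) := rfl

theorem pairRot_left (hij : i ≠ j) (t : ℝ) (x : Fin N → ℂ) :
    pairRot i j t x i = (x i + x j) / 2 + Complex.exp (t * Complex.I) * ((x i - x j) / 2) := by
  simp [pairRot_apply, hij]
  ring

theorem pairRot_right (hij : i ≠ j) (t : ℝ) (x : Fin N → ℂ) :
    pairRot i j t x j = (x i + x j) / 2 - Complex.exp (t * Complex.I) * ((x i - x j) / 2) := by
  simp [pairRot_apply, hij.symm]
  ring

theorem pairRot_of_ne {k : Fin N} (hi : k ≠ i) (hj : k ≠ j) (t : ℝ) (x : Fin N → ℂ) :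
    pairRot i j t x k = x k := by
  simp [pairRot_apply, hi, hj]

theorem pairRot_sub (hij : i ≠ j) (t : ℝ) (x : Fin N → ℂ) :
    pairRot i j t x i - pairRot i j t x j = Complex.exp (t * Complex.I) * (x i - x j) := by
  rw [pairRot_left hij, pairRot_right hij]
  ring

theorem pairRot_add (hij : i ≠ j) (t : ℝ) (x : Fin N → ℂ) :
    pairRot i j t x i + pairRot i j t x j = x i + x j := by
  rw [pairRot_left hij, pairRot_right hij]
  ring

theorem pairRot_zero (x : Fin N → ℂ) : pairRot i j 0 x = x := by
  simp [pairRot_apply]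

theorem pairRot_pi (hij : i ≠ j) (x : Fin N → ℂ) :
    pairRot i j Real.pi x = x ∘ Equiv.swap i j := by
  ext k
  rcases eq_or_ne k i with rfl | hi
  · simp [pairRot_left hij]
    ring
  rcases eq_or_ne k j with rfl | hj
  · simp [pairRot_right hij]
    ring
  simp [pairRot_of_ne hi hj, Equiv.swap_apply_of_ne_of_ne hi hj]

theorem pairRot_neg_pairRot (hij : i ≠ j) (t : ℝ) (x : Fin N → ℂ) :
    pairRot i j (-t) (pairRot i j t x) = x := by
  have h : Complex.exp ((-t : ℝ) * Complex.I) * Complex.exp (t * Complex.I) = 1 := by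
    rw [← Complex.exp_add]
    simp
  ext k
  rcases eq_or_ne k i with rfl | hi
  · rw [pairRot_left hij, pairRot_add hij, pairRot_sub hij]
    linear_combination ((x k - x j) / 2) * h
  rcases eq_or_ne k j with rfl | hj
  · rw [pairRot_right hij, pairRot_add hij, pairRot_sub hij]
    linear_combination (-(x i - x k) / 2) * h
  rw [pairRot_of_ne hi hj, pairRot_of_ne hi hj]

theorem pairRot_pairRot_neg (hij : i ≠ j) (t : ℝ) (x : Fin N → ℂ) :
    pairRot i j t (pairRot i j (-t) x) = x := by
  simpa using pairRot_neg_pairRot hij (-t) x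

theorem norm_pairRot_sub (hij : i ≠ j) (t : ℝ) (x : Fin N → ℂ) :
    ‖pairRot i j t x i - pairRot i j t x j‖ = ‖x i - x j‖ := by
  rw [pairRot_sub hij, norm_mul, Complex.norm_exp_ofReal_mul_I, one_mul]

theorem sum_norm_sq_pairRot (hij : i ≠ j) (t : ℝ) (x : Fin N → ℂ) :
    ∑ k, ‖pairRot i j t x k‖ ^ 2 = ∑ k, ‖x k‖ ^ 2 := by
  have split (y : Fin N → ℂ) : ∑ k, ‖y k‖ ^ 2 =
      (‖y i + y j‖ ^ 2 + ‖y i - y j‖ ^ 2) / 2 +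
        ∑ k ∈ (Finset.univ.erase i).erase j, ‖y k‖ ^ 2 := by
    rw [← Finset.add_sum_erase _ _ (Finset.mem_univ i),
      ← Finset.add_sum_erase _ _ (Finset.mem_erase.2 ⟨hij.symm, Finset.mem_univ j⟩)]
    have := parallelogram_law_with_norm ℝ (y i) (y j)
    linarith
  rw [split, split, pairRot_add hij, norm_pairRot_sub hij]
  congr 1
  refine Finset.sum_congr rfl fun k hk => ?_
  simp only [Finset.mem_erase] at hk
  rw [pairRot_of_ne hk.2.1 hk.1]

theorem continuous_uncurry_pairRot :
    Continuous fun p : (Fin N → ℂ) × ℝ => pairRot i j p.2 p.1 := by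
  simp only [pairRot_apply]
  fun_prop

theorem continuous_pairRot_angle (x : Fin N → ℂ) : Continuous fun t => pairRot i j t x := by
  simp only [pairRot_apply]
  fun_prop

theorem continuous_pairRot (t : ℝ) : Continuous (pairRot i j t) :=
  (pairRot i j t).continuous_of_finiteDimensional

theorem measurePreserving_pairRot (hij : i ≠ j) (t : ℝ) :
    MeasurePreserving (pairRot i j t) (volume : Measure (Fin N → ℂ)) volume := by
  set B : Set (Fin N → ℂ) := {x | ∑ k, ‖x k‖ ^ 2 < 1} with hB
  have hBopen : IsOpen B := isOpen_lt (by fun_prop) continuous_const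
  have hBpos : volume B ≠ 0 := (hBopen.measure_pos volume ⟨0, by simp [hB]⟩).ne'
  have hBfin : volume B ≠ ⊤ := by
    refine ((measure_mono fun x hx => ?_).trans_lt
      (measure_closedBall_lt_top (x := (0 : Fin N → ℂ)) (r := 1))).ne
    rw [mem_closedBall_zero_iff, pi_norm_le_iff_of_nonneg zero_le_one]
    intro k
    have h1 : ‖x k‖ ^ 2 ≤ ∑ k, ‖x k‖ ^ 2 :=
      Finset.single_le_sum (f := fun k => ‖x k‖ ^ 2) (fun _ _ => by positivity)
        (Finset.mem_univ k)
    have h2 : ∑ k, ‖x k‖ ^ 2 < 1 := hx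
    nlinarith [norm_nonneg (x k)]
  have himg : pairRot i j t '' B = B := by
    ext x
    constructor
    · rintro ⟨y, hy, rfl⟩
      simpa [hB, sum_norm_sq_pairRot hij] using hy
    · intro hx
      exact ⟨pairRot i j (-t) x, by simpa [hB, sum_norm_sq_pairRot hij] using hx,
        pairRot_pairRot_neg hij t x⟩
  have hdet : |LinearMap.det (pairRot i j t)| = 1 := by
    have h := Measure.addHaar_image_linearMap (volume : Measure (Fin N → ℂ)) (pairRot i j t) B
    rw [himg] at h
    have h1 : ENNReal.ofReal |LinearMap.det (pairRot i j t)| = 1 :=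
      (ENNReal.mul_left_inj hBpos hBfin).1 (by rw [← h, one_mul])
    simpa using h1
  refine ⟨(continuous_pairRot t).measurable, ?_⟩
  rw [Measure.map_linearMap_addHaar_eq_smul_addHaar _ (fun h => by simp [h] at hdet), abs_inv,
    hdet]
  simp

theorem lintegral_eq_lintegral_pairRot (hij : i ≠ j) {E : Set (Fin N → ℂ)}
    (hE : MeasurableSet E) (hinv : ∀ t, ∀ x ∈ E, pairRot i j t x ∈ E)
    {F : (Fin N → ℂ) → ENNReal} (hF : Measurable F) :
    ENNReal.ofReal Real.pi * ∫⁻ x in E, F x =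
      ∫⁻ x in E, ∫⁻ t in Set.Ioc 0 Real.pi, F (pairRot i j t x) := by
  have hpre (t : ℝ) : pairRot i j t ⁻¹' E = E := by
    ext x
    exact ⟨fun hx => pairRot_neg_pairRot hij t x ▸ hinv (-t) _ hx, hinv t x⟩
  have hinner (t : ℝ) : ∫⁻ x in E, F (pairRot i j t x) = ∫⁻ x in E, F x := by
    conv_lhs => rw [← hpre t]
    exact (measurePreserving_pairRot hij t).setLIntegral_comp_preimage hE hF
  rw [lintegral_lintegral_swap]
  · simp [hinner, mul_comm]
  · exact (hF.comp continuous_uncurry_pairRot.measurable).aemeasurable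

theorem pairRot_mem_pi {Ω : Set ℂ} (hij : i ≠ j) (t : ℝ) {x : Fin N → ℂ}
    (hx : x ∈ Set.univ.pi (fun _ : Fin N => Ω)) (hxij : (x i, x j) ∈ OcO Ω) :
    pairRot i j t x ∈ Set.univ.pi (fun _ : Fin N => Ω) := by
  have hmem (y : ℂ) (hy : dist ((x i + x j) / 2) y = ‖x i - x j‖ / 2) : y ∈ Ω := by
    by_contra hyΩ
    have h := hxij.2.2.trans_le (Metric.infEDist_le_edist_of_mem (x := (x i + x j) / 2) hyΩ)
    rw [edist_dist, hy] at h
    exact lt_irrefl _ h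
  intro k _
  rcases eq_or_ne k i with rfl | hi
  · refine hmem _ ?_
    rw [pairRot_left hij, dist_self_add_right, norm_mul, Complex.norm_exp_ofReal_mul_I]
    simp
  rcases eq_or_ne k j with rfl | hj
  · refine hmem _ ?_
    rw [pairRot_right hij, dist_eq_norm, sub_sub_cancel, norm_mul,
      Complex.norm_exp_ofReal_mul_I]
    simp
  rw [pairRot_of_ne hi hj]
  exact hx k trivial

theorem pairRot_mem_OcO {Ω : Set ℂ} (hij : i ≠ j) (t : ℝ) {x : Fin N → ℂ}
    (hx : x ∈ Set.univ.pi (fun _ : Fin N => Ω)) (hxij : (x i, x j) ∈ OcO Ω) :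
    (pairRot i j t x i, pairRot i j t x j) ∈ OcO Ω := by
  have h := pairRot_mem_pi hij t hx hxij
  refine ⟨h i trivial, h j trivial, ?_⟩
  rw [pairRot_add hij, norm_pairRot_sub hij]
  exact hxij.2.2

theorem isOpen_OcO {Ω : Set ℂ} (hΩ : IsOpen Ω) : IsOpen (OcO Ω) := by
  refine (hΩ.preimage continuous_fst).inter ((hΩ.preimage continuous_snd).inter
    (isOpen_lt (ENNReal.continuous_ofReal.comp (by fun_prop)) ?_))
  exact Metric.continuous_infEDist.comp (by fun_prop)

theorem hasDerivAt_pairRot (hij : i ≠ j) (x : Fin N → ℂ) (t : ℝ) :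
    HasDerivAt (fun t => pairRot i j t x)
      ((Complex.I * (pairRot i j t x i - pairRot i j t x j) / 2) •
        (Pi.single i 1 - Pi.single j 1)) t := by
  have h : HasDerivAt (fun t : ℝ => (Complex.exp (t * Complex.I) - 1) / 2 * (x i - x j))
      (Complex.I * (pairRot i j t x i - pairRot i j t x j) / 2) t := by
    refine (((((hasDerivAt_id' t).ofReal_comp.mul_const Complex.I).cexp.sub_const 1).div_const
      2).mul_const (x i - x j)).congr_deriv ?_
    rw [pairRot_sub hij]
    push_cast
    ring
  simp only [pairRot_apply]
  exact (h.smul_const _).const_add x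

theorem ae_norm_sub_midpoint_ne {l : Fin N} (hi : l ≠ i) (hj : l ≠ j) :
    ∀ᵐ x : Fin N → ℂ, ‖x l - (x i + x j) / 2‖ ≠ ‖(x i - x j) / 2‖ := by
  refine ae_mem_of_ae_add_linearMap_mem (LinearMap.single ℝ (fun _ : Fin N => ℂ) l)
    volume volume (s := {x | ‖x l - (x i + x j) / 2‖ ≠ ‖(x i - x j) / 2‖}) ?_ fun y => ?_
  · exact (measurableSet_eq_fun (by fun_prop) (by fun_prop)).compl
  · have h0 : volume (Metric.sphere ((y i + y j) / 2 - y l) ‖(y i - y j) / 2‖) = 0 :=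
      Measure.addHaar_sphere _ _ _
    filter_upwards [compl_mem_ae_iff.2 h0] with z hz h
    apply hz
    simp only [LinearMap.coe_single, Pi.add_apply, Pi.single_eq_same,
      Pi.single_eq_of_ne hi.symm, Pi.single_eq_of_ne hj.symm, add_zero] at h
    rw [mem_sphere_iff_norm, ← h]
    congr 1
    ring

end pairRot

/-- The statistics vector potential `A_j`, with `ℝ²` identified with `ℂ`. -/
def vecPot (α : ℝ) {N : ℕ} (j : Fin N) (x : Fin N → ℂ) : ℂ :=
  (α : ℂ) * ∑ k ∈ Finset.univ.erase j,
    Complex.I * (x j - x k) / ((‖x j - x k‖ : ℂ) ^ 2)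

/-- The component of the vector potential along the pair rotation `pairRot i j`. -/
def pairPot (α : ℝ) {N : ℕ} (i j : Fin N) (x : Fin N → ℂ) : ℝ :=
  (starRingEnd ℂ (vecPot α i x - vecPot α j x) * (Complex.I * (x i - x j) / 2)).re

/-- The covariant derivative along the pair rotation `pairRot i j`. -/
def pairCov (α : ℝ) {N : ℕ} (u : (Fin N → ℂ) → ℂ) (i j : Fin N) (x : Fin N → ℂ) : ℂ :=
  -Complex.I * fderiv ℝ u x ((Complex.I * (x i - x j) / 2) •
    (Pi.single i 1 - Pi.single j 1)) + pairPot α i j x * u x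

section pairPot

variable {N : ℕ} {i j : Fin N}

theorem measurable_vecPot (α : ℝ) (j : Fin N) : Measurable (vecPot α j) := by
  unfold vecPot
  fun_prop

theorem measurable_pairPot (α : ℝ) (i j : Fin N) : Measurable (pairPot α i j) := by
  unfold pairPot
  have := measurable_vecPot α i
  have := measurable_vecPot α j
  exact Complex.measurable_re.comp ((Complex.continuous_conj.measurable.comp
    (by fun_prop)).mul (by fun_prop))

theorem measurable_pairCov (α : ℝ) {u : (Fin N → ℂ) → ℂ} (hu : ContDiff ℝ (⊤ : ℕ∞) u)
    (i j : Fin N) : Measurable (pairCov α u i j) := by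
  unfold pairCov
  have h1 : Continuous fun x : Fin N → ℂ => fderiv ℝ u x ((Complex.I * (x i - x j) / 2) •
      (Pi.single i 1 - Pi.single j 1)) :=
    (hu.continuous_fderiv (by simp)).clm_apply (by fun_prop)
  have h2 := measurable_pairPot α i j
  have h3 := hu.continuous.measurable
  have h4 := h1.measurable
  exact (h4.const_mul _).add ((Complex.measurable_ofReal.comp h2).mul h3)

theorem re_conj_perp_div_mul (w v : ℂ) :
    (starRingEnd ℂ (Complex.I * w / ((‖w‖ : ℂ) ^ 2)) * (Complex.I * v)).re = (v / w).re := by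
  have hI : starRingEnd ℂ Complex.I * Complex.I = 1 := by simp
  have h : starRingEnd ℂ (Complex.I * w / ((‖w‖ : ℂ) ^ 2)) * (Complex.I * v) =
      v * (starRingEnd ℂ w / ((‖w‖ : ℂ) ^ 2)) := by
    simp only [map_div₀, map_mul, map_pow, Complex.conj_ofReal]
    linear_combination (starRingEnd ℂ w * v / ((‖w‖ : ℂ) ^ 2)) * hI
  rw [h, div_eq_mul_inv v w, Complex.inv_def, Complex.normSq_eq_norm_sq]
  push_cast
  rfl

theorem re_conj_vecPot_mul (α : ℝ) (i : Fin N) (x : Fin N → ℂ) (v : ℂ) :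
    (starRingEnd ℂ (vecPot α i x) * (Complex.I * v)).re =
      α * ∑ k ∈ Finset.univ.erase i, (v / (x i - x k)).re := by
  simp only [vecPot, map_mul, map_sum, Complex.conj_ofReal]
  rw [mul_assoc, Complex.re_ofReal_mul, Finset.sum_mul, Complex.re_sum]
  congr 1
  exact Finset.sum_congr rfl fun k _ => by rw [← re_conj_perp_div_mul, map_div₀, map_mul]

theorem pairPot_eq (α : ℝ) (hij : i ≠ j) {x : Fin N → ℂ} (hx : x i ≠ x j)
    (hk : ∀ k, k ≠ i → k ≠ j → ‖x k - (x i + x j) / 2‖ ≠ ‖(x i - x j) / 2‖) :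
    pairPot α i j x = α * (1 + 2 * ∑ k ∈ (Finset.univ.erase i).erase j,
      (((x i - x j) / 2) ^ 2 / (((x i - x j) / 2) ^ 2 - (x k - (x i + x j) / 2) ^ 2)).re) := by
  have hr : x i - x j ≠ 0 := sub_ne_zero.2 hx
  have hr' : x j - x i ≠ 0 := sub_ne_zero.2 hx.symm
  unfold pairPot
  rw [map_sub, sub_mul, Complex.sub_re, mul_div_assoc, re_conj_vecPot_mul, re_conj_vecPot_mul,
    ← mul_sub]
  congr 1
  rw [← Finset.add_sum_erase (Finset.univ.erase i) _
      (Finset.mem_erase.2 ⟨hij.symm, Finset.mem_univ j⟩),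
    ← Finset.add_sum_erase (Finset.univ.erase j) _
      (Finset.mem_erase.2 ⟨hij, Finset.mem_univ i⟩),
    Finset.erase_right_comm (a := j), add_sub_add_comm, ← Finset.sum_sub_distrib,
    Finset.mul_sum]
  congr 1
  · have h1 : (x i - x j) / 2 / (x i - x j) = ((1 / 2 : ℝ) : ℂ) := by
      push_cast
      field_simp
    have h2 : (x i - x j) / 2 / (x j - x i) = ((-1 / 2 : ℝ) : ℂ) := by
      push_cast
      field_simp
      ring
    rw [h1, h2, Complex.ofReal_re, Complex.ofReal_re]
    norm_num
  · refine Finset.sum_congr rfl fun k hkm => ?_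
    simp only [Finset.mem_erase] at hkm
    have hn := hk k hkm.2.1 hkm.1
    have hi : x i - x k ≠ 0 := by
      intro h
      apply hn
      rw [← sub_eq_zero.1 h]
      congr 1
      ring
    have hj : x j - x k ≠ 0 := by
      intro h
      apply hn
      rw [← sub_eq_zero.1 h, ← norm_neg]
      congr 1
      ring
    have hden : ((x i - x j) / 2) ^ 2 - (x k - (x i + x j) / 2) ^ 2 =
        -((x i - x k) * (x j - x k)) := by ring
    have h2 (z : ℂ) : 2 * z.re = ((2 : ℝ) * z).re := by rw [Complex.re_ofReal_mul]
    rw [← Complex.sub_re, h2, hden]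
    congr 1
    push_cast
    field_simp
    ring

theorem four_mul_norm_pairCov_sq_le (α : ℝ) (u : (Fin N → ℂ) → ℂ) (i j : Fin N)
    (x : Fin N → ℂ) :
    4 * ‖pairCov α u i j x‖ ^ 2 ≤ ‖x i - x j‖ ^ 2 *
      (‖(-Complex.I * fderiv ℝ u x (Pi.single i 1) + ((vecPot α i x).re : ℂ) * u x) -
          (-Complex.I * fderiv ℝ u x (Pi.single j 1) + ((vecPot α j x).re : ℂ) * u x)‖ ^ 2 +
        ‖(-Complex.I * fderiv ℝ u x (Pi.single i Complex.I) + ((vecPot α i x).im : ℂ) * u x) -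
          (-Complex.I * fderiv ℝ u x (Pi.single j Complex.I) +
            ((vecPot α j x).im : ℂ) * u x)‖ ^ 2) := by
  have hsingle (k : Fin N) (w : ℂ) : fderiv ℝ u x (Pi.single k w) =
      w.re * fderiv ℝ u x (Pi.single k 1) + w.im * fderiv ℝ u x (Pi.single k Complex.I) := by
    have h : (Pi.single k w : Fin N → ℂ) =
        w.re • (Pi.single k 1 : Fin N → ℂ) + w.im • (Pi.single k Complex.I : Fin N → ℂ) := by
      rw [← Pi.single_smul, ← Pi.single_smul, ← Pi.single_add]
      congr 1
      simp [Complex.re_add_im]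
    rw [h, map_add, map_smul, map_smul, Complex.real_smul, Complex.real_smul]
  set a := (-Complex.I * fderiv ℝ u x (Pi.single i 1) + ((vecPot α i x).re : ℂ) * u x) -
    (-Complex.I * fderiv ℝ u x (Pi.single j 1) + ((vecPot α j x).re : ℂ) * u x) with ha
  set b := (-Complex.I * fderiv ℝ u x (Pi.single i Complex.I) +
    ((vecPot α i x).im : ℂ) * u x) - (-Complex.I * fderiv ℝ u x (Pi.single j Complex.I) +
    ((vecPot α j x).im : ℂ) * u x) with hb
  set w : ℂ := Complex.I * (x i - x j) with hw
  have hcov : 2 * pairCov α u i j x = w.re * a + w.im * b := by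
    have h1 : fderiv ℝ u x ((w / 2) • (Pi.single i 1 - Pi.single j 1)) =
        fderiv ℝ u x (Pi.single i (w / 2)) - fderiv ℝ u x (Pi.single j (w / 2)) := by
      rw [smul_sub, ← Pi.single_smul, ← Pi.single_smul, smul_eq_mul, mul_one, map_sub]
    have hre : (w / 2).re = w.re / 2 := Complex.div_ofNat_re w 2
    have him : (w / 2).im = w.im / 2 := Complex.div_ofNat_im w 2
    have h2 : pairPot α i j x = ((vecPot α i x - vecPot α j x).re * w.re +
        (vecPot α i x - vecPot α j x).im * w.im) / 2 := by
      rw [pairPot, ← hw, Complex.mul_re, hre, him, Complex.conj_re, Complex.conj_im]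
      ring
    rw [pairCov, ← hw, h1, hsingle i, hsingle j, hre, him, h2, ha, hb, Complex.sub_re,
      Complex.sub_im]
    push_cast
    ring
  have hwn : ‖x i - x j‖ ^ 2 = w.re ^ 2 + w.im ^ 2 := by
    have : ‖x i - x j‖ = ‖w‖ := by rw [hw, norm_mul, Complex.norm_I, one_mul]
    rw [this, ← Complex.normSq_eq_norm_sq, Complex.normSq_apply]
    ring
  have hn : 4 * ‖pairCov α u i j x‖ ^ 2 = ‖w.re * a + w.im * b‖ ^ 2 := by
    rw [← hcov, norm_mul, mul_pow]
    norm_num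
  rw [hn, hwn]
  have h3 : ‖w.re * a + w.im * b‖ ≤ |w.re| * ‖a‖ + |w.im| * ‖b‖ := by
    refine (norm_add_le _ _).trans_eq ?_
    simp
  calc ‖w.re * a + w.im * b‖ ^ 2 ≤ (|w.re| * ‖a‖ + |w.im| * ‖b‖) ^ 2 := by gcongr
    _ ≤ (|w.re| ^ 2 + |w.im| ^ 2) * (‖a‖ ^ 2 + ‖b‖ ^ 2) := by
      nlinarith [sq_nonneg (|w.re| * ‖b‖ - |w.im| * ‖a‖)]
    _ = _ := by rw [sq_abs, sq_abs]

theorem sum_lt_norm_sub_sq_le (z : Fin N → ℂ) :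
    ∑ i, ∑ j, (if i < j then ‖z i - z j‖ ^ 2 else 0) ≤ N * ∑ j, ‖z j‖ ^ 2 := by
  have hsym : ∑ i, ∑ j, ‖z i - z j‖ ^ 2 =
      2 * ∑ i, ∑ j, (if i < j then ‖z i - z j‖ ^ 2 else 0) := by
    rw [two_mul]
    nth_rewrite 3 [Finset.sum_comm]
    rw [← Finset.sum_add_distrib]
    refine Finset.sum_congr rfl fun i _ => ?_
    rw [← Finset.sum_add_distrib]
    refine Finset.sum_congr rfl fun j _ => ?_
    rcases lt_trichotomy i j with h | rfl | h
    · simp [h, h.not_gt]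
    · simp
    · simp [h, h.not_gt, norm_sub_rev (z i) (z j)]
  have hre (v : ℂ) : ‖v‖ ^ 2 = v.re ^ 2 + v.im ^ 2 := by
    rw [← Complex.normSq_eq_norm_sq, Complex.normSq_apply]
    ring
  have hexp : ∑ i, ∑ j, ‖z i - z j‖ ^ 2 = 2 * (N * ∑ j, ‖z j‖ ^ 2) - 2 * ‖∑ j, z j‖ ^ 2 := by
    have hdot : ‖∑ j, z j‖ ^ 2 = ∑ i, ∑ j, ((z i).re * (z j).re + (z i).im * (z j).im) := by
      rw [hre, Complex.re_sum, Complex.im_sum, sq, sq, Finset.sum_mul_sum, Finset.sum_mul_sum]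
      simp only [Finset.sum_add_distrib]
    have hterm (i j : Fin N) : ‖z i - z j‖ ^ 2 = ‖z i‖ ^ 2 + ‖z j‖ ^ 2 -
        2 * ((z i).re * (z j).re + (z i).im * (z j).im) := by
      simp only [hre, Complex.sub_re, Complex.sub_im]
      ring
    simp only [hterm]
    simp only [hdot, Finset.sum_sub_distrib, Finset.sum_add_distrib, ← Finset.mul_sum,
      Finset.sum_const, Finset.card_univ, Fintype.card_fin, nsmul_eq_mul]
    ring
  nlinarith [sq_nonneg ‖∑ j, z j‖]

theorem four_div_mul_sum_pairCov_le (α : ℝ) (u : (Fin N → ℂ) → ℂ) (hN : 0 < N)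
    (x : Fin N → ℂ) :
    4 / (N : ℝ) * ∑ i, ∑ j, (if i < j then ‖pairCov α u i j x‖ ^ 2 / ‖x i - x j‖ ^ 2 else 0) ≤
      ∑ j, covSq α u j x := by
  set a : Fin N → ℂ := fun j =>
    -Complex.I * fderiv ℝ u x (Pi.single j 1) + ((vecPot α j x).re : ℂ) * u x
  set b : Fin N → ℂ := fun j =>
    -Complex.I * fderiv ℝ u x (Pi.single j Complex.I) + ((vecPot α j x).im : ℂ) * u x
  have hcov : ∑ j, covSq α u j x = ∑ j, ‖a j‖ ^ 2 + ∑ j, ‖b j‖ ^ 2 := by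
    rw [← Finset.sum_add_distrib]
    rfl
  have hN' : (0 : ℝ) < N := by exact_mod_cast hN
  have h1 := sum_lt_norm_sub_sq_le a
  have h2 := sum_lt_norm_sub_sq_le b
  have h3 : 4 * ∑ i, ∑ j,
      (if i < j then ‖pairCov α u i j x‖ ^ 2 / ‖x i - x j‖ ^ 2 else 0) ≤
      ∑ i, ∑ j, (if i < j then ‖a i - a j‖ ^ 2 else 0) +
        ∑ i, ∑ j, (if i < j then ‖b i - b j‖ ^ 2 else 0) := by
    simp only [Finset.mul_sum, ← Finset.sum_add_distrib]
    refine Finset.sum_le_sum fun i _ => Finset.sum_le_sum fun j _ => ?_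
    split_ifs
    · rw [← mul_div_assoc]
      exact div_le_of_le_mul₀ (by positivity) (by positivity)
        ((four_mul_norm_pairCov_sq_le α u i j x).trans_eq (mul_comm _ _))
    · simp
  rw [hcov, div_mul_eq_mul_div, div_le_iff₀ hN']
  linarith

theorem statC_nonneg (α : ℝ) (N : ℕ) : 0 ≤ statC α N :=
  Real.iInf_nonneg fun _ => Real.iInf_nonneg fun _ => abs_nonneg _

theorem statC_le (α : ℝ) {N p : ℕ} (hp : p < N - 1) (n : ℤ) :
    statC α N ≤ |2 * n + α * (1 + 2 * p)| := by
  have hbdd (p : Fin (N - 1)) :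
      BddBelow (Set.range fun q : ℤ => |(2 * ((p : ℕ) : ℝ) + 1) * α - 2 * (q : ℝ)|) :=
    ⟨0, by rintro _ ⟨q, rfl⟩; exact abs_nonneg _⟩
  refine (ciInf_le (Set.finite_range _).bddBelow ⟨p, hp⟩).trans
    ((ciInf_le (hbdd ⟨p, hp⟩) (-n)).trans_eq ?_)
  congr 1
  push_cast
  ring

theorem pairPot_pairRot (α : ℝ) (hij : i ≠ j) {x : Fin N → ℂ} (hx : x i ≠ x j)
    (hk : ∀ k, k ≠ i → k ≠ j → ‖x k - (x i + x j) / 2‖ ≠ ‖(x i - x j) / 2‖) (t : ℝ) :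
    pairPot α i j (pairRot i j t x) =
      α * (1 + 2 * ∑ k ∈ (Finset.univ.erase i).erase j,
        (((x i - x j) / 2) ^ 2 * Complex.exp (t * Complex.I) ^ 2 /
          (((x i - x j) / 2) ^ 2 * Complex.exp (t * Complex.I) ^ 2 -
            (x k - (x i + x j) / 2) ^ 2)).re) := by
  rw [pairPot_eq α hij, pairRot_add hij, pairRot_sub hij]
  · congr 3
    refine Finset.sum_congr rfl fun k hkm => ?_
    simp only [Finset.mem_erase] at hkm
    rw [pairRot_of_ne hkm.2.1 hkm.1, mul_div_assoc, mul_pow,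
      mul_comm (Complex.exp (t * Complex.I) ^ 2)]
  · rw [← sub_ne_zero, pairRot_sub hij]
    exact mul_ne_zero (Complex.exp_ne_zero _) (sub_ne_zero.2 hx)
  · intro k hi hj
    rw [pairRot_add hij, norm_div, norm_pairRot_sub hij, pairRot_of_ne hi hj, ← norm_div]
    exact hk k hi hj

theorem mul_exp_sq_sub_ne_zero {z w : ℂ} (h : ‖w‖ ≠ ‖z‖) (t : ℝ) :
    z * Complex.exp (t * Complex.I) ^ 2 - w ≠ 0 := by
  intro h0
  apply h
  rw [← sub_eq_zero.1 h0, norm_mul, norm_pow, Complex.norm_exp_ofReal_mul_I, one_pow, mul_one]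

theorem continuous_div_sub_of_norm_ne {z w : ℂ} (h : ‖w‖ ≠ ‖z‖) :
    Continuous fun t : ℝ => z * Complex.exp (t * Complex.I) ^ 2 /
      (z * Complex.exp (t * Complex.I) ^ 2 - w) :=
  Continuous.div (by fun_prop) (by fun_prop) (mul_exp_sq_sub_ne_zero h)

theorem norm_sq_ne_norm_sq {z w : ℂ} (h : ‖w‖ ≠ ‖z‖) : ‖w ^ 2‖ ≠ ‖z ^ 2‖ := by
  rw [norm_pow, norm_pow]
  exact fun h' => h ((pow_left_inj₀ (norm_nonneg _) (norm_nonneg _) two_ne_zero).1 h')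

theorem continuous_pairPot_pairRot (α : ℝ) (hij : i ≠ j) {x : Fin N → ℂ} (hx : x i ≠ x j)
    (hk : ∀ k, k ≠ i → k ≠ j → ‖x k - (x i + x j) / 2‖ ≠ ‖(x i - x j) / 2‖) :
    Continuous fun t => pairPot α i j (pairRot i j t x) := by
  simp only [pairPot_pairRot α hij hx hk]
  refine continuous_const.mul (continuous_const.add (continuous_const.mul
    (continuous_finsetSum _ fun k hkm => ?_)))
  simp only [Finset.mem_erase] at hkm
  exact Complex.continuous_re.comp
    (continuous_div_sub_of_norm_ne (norm_sq_ne_norm_sq (hk k hkm.2.1 hkm.1)))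

/-- The flux of the vector potential through half a turn of the pair `i`, `j` is fixed by the
number of particles enclosed by their orbit. -/
theorem exists_integral_pairPot_eq (α : ℝ) (hij : i ≠ j) {x : Fin N → ℂ} (hx : x i ≠ x j)
    (hk : ∀ k, k ≠ i → k ≠ j → ‖x k - (x i + x j) / 2‖ ≠ ‖(x i - x j) / 2‖) :
    ∃ p < N - 1, ∫ t in (0 : ℝ)..Real.pi, pairPot α i j (pairRot i j t x) =
      Real.pi * (α * (1 + 2 * (p : ℕ))) := by
  set S := (Finset.univ.erase i).erase j with hS
  have hmem {k : Fin N} (hkm : k ∈ S) :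
      ‖(x k - (x i + x j) / 2) ^ 2‖ ≠ ‖((x i - x j) / 2) ^ 2‖ := by
    simp only [hS, Finset.mem_erase] at hkm
    exact norm_sq_ne_norm_sq (hk k hkm.2.1 hkm.1)
  have hcont {k : Fin N} (hkm : k ∈ S) := continuous_div_sub_of_norm_ne (hmem hkm)
  refine ⟨(S.filter fun k => ‖(x k - (x i + x j) / 2) ^ 2‖ < ‖((x i - x j) / 2) ^ 2‖).card,
    (Finset.card_filter_le _ _).trans_lt ?_, ?_⟩
  · have := i.pos
    have hlt : S.card < (Finset.univ.erase i).card :=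
      Finset.card_erase_lt_of_mem (Finset.mem_erase.2 ⟨hij.symm, Finset.mem_univ j⟩)
    rwa [Finset.card_erase_of_mem (Finset.mem_univ i), Finset.card_univ, Fintype.card_fin]
      at hlt
  · simp only [pairPot_pairRot α hij hx hk, ← hS]
    have hterm {k : Fin N} (hkm : k ∈ S) : ∫ t in (0 : ℝ)..Real.pi,
        (((x i - x j) / 2) ^ 2 * Complex.exp (t * Complex.I) ^ 2 /
          (((x i - x j) / 2) ^ 2 * Complex.exp (t * Complex.I) ^ 2 -
            (x k - (x i + x j) / 2) ^ 2)).re =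
        if ‖(x k - (x i + x j) / 2) ^ 2‖ < ‖((x i - x j) / 2) ^ 2‖ then Real.pi else 0 := by
      have h := Complex.reCLM.intervalIntegral_comp_comm
        ((hcont hkm).intervalIntegrable (μ := volume) 0 Real.pi)
      simp only [Complex.reCLM_apply] at h
      rw [h, integral_div_sub_of_norm_ne (hmem hkm)]
      split_ifs <;> simp
    have hre {k : Fin N} (hkm : k ∈ S) : Continuous fun t : ℝ =>
        (((x i - x j) / 2) ^ 2 * Complex.exp (t * Complex.I) ^ 2 /
          (((x i - x j) / 2) ^ 2 * Complex.exp (t * Complex.I) ^ 2 -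
            (x k - (x i + x j) / 2) ^ 2)).re := Complex.continuous_re.comp (hcont hkm)
    have hsum : Continuous fun t : ℝ => 2 * ∑ k ∈ S,
        (((x i - x j) / 2) ^ 2 * Complex.exp (t * Complex.I) ^ 2 /
          (((x i - x j) / 2) ^ 2 * Complex.exp (t * Complex.I) ^ 2 -
            (x k - (x i + x j) / 2) ^ 2)).re :=
      continuous_const.mul (continuous_finsetSum _ fun k hkm => hre hkm)
    rw [intervalIntegral.integral_const_mul, intervalIntegral.integral_add
      (continuous_const.intervalIntegrable _ _) (hsum.intervalIntegrable _ _),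
      intervalIntegral.integral_const_mul, intervalIntegral.integral_finsetSum
      fun k hkm => (hre hkm).intervalIntegrable _ _, Finset.sum_congr rfl fun k hkm => hterm hkm,
      ← Finset.sum_filter, Finset.sum_const, nsmul_eq_mul]
    simp
    ring

theorem statC_sq_mul_integral_le (α : ℝ) {u : (Fin N → ℂ) → ℂ} (hu : IsAnyonWF N u)
    (hij : i ≠ j) {x : Fin N → ℂ} (hx : x i ≠ x j)
    (hk : ∀ k, k ≠ i → k ≠ j → ‖x k - (x i + x j) / 2‖ ≠ ‖(x i - x j) / 2‖) :
    statC α N ^ 2 * ∫ t in (0 : ℝ)..Real.pi, ‖u (pairRot i j t x)‖ ^ 2 ≤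
      ∫ t in (0 : ℝ)..Real.pi, ‖pairCov α u i j (pairRot i j t x)‖ ^ 2 := by
  obtain ⟨p, hp, hflux⟩ := exists_integral_pairPot_eq α hij hx hk
  have hrot := continuous_pairRot_angle (i := i) (j := j) x
  have hdiff : Differentiable ℝ u := hu.smooth.differentiable (by simp)
  exact sq_mul_integral_le_integral_covDeriv
    (fun t => (hdiff _).hasFDerivAt.comp_hasDerivAt t (hasDerivAt_pairRot hij x t))
    (((hu.smooth.continuous_fderiv (by simp)).comp hrot).clm_apply
      (((by fun_prop : Continuous fun y : Fin N → ℂ => Complex.I * (y i - y j) / 2).comp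
        hrot).smul continuous_const))
    (by rw [Function.comp_apply, Function.comp_apply, pairRot_pi hij, pairRot_zero, hu.symmetric])
    (continuous_pairPot_pairRot α hij hx hk) hflux (statC_nonneg α N) (statC_le α hp)

theorem continuous_pairCov_pairRot (α : ℝ) {u : (Fin N → ℂ) → ℂ} (hu : IsAnyonWF N u)
    (hij : i ≠ j) {x : Fin N → ℂ} (hx : x i ≠ x j)
    (hk : ∀ k, k ≠ i → k ≠ j → ‖x k - (x i + x j) / 2‖ ≠ ‖(x i - x j) / 2‖) :
    Continuous fun t => pairCov α u i j (pairRot i j t x) := by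
  have hrot := continuous_pairRot_angle (i := i) (j := j) x
  refine (continuous_const.mul (((hu.smooth.continuous_fderiv (by simp)).comp hrot).clm_apply
      (((by fun_prop : Continuous fun y : Fin N → ℂ => Complex.I * (y i - y j) / 2).comp
        hrot).smul continuous_const))).add ?_
  exact (Complex.continuous_ofReal.comp (continuous_pairPot_pairRot α hij hx hk)).mul
    (hu.smooth.continuous.comp hrot)

/-- The configurations in `Ω^N` whose pair `i`, `j` lies in `Ω∘Ω`. -/
def pairSet {N : ℕ} (Ω : Set ℂ) (i j : Fin N) : Set (Fin N → ℂ) :=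
  Set.univ.pi (fun _ : Fin N => Ω) ∩ {x | (x i, x j) ∈ OcO Ω}

theorem isOpen_pairSet {Ω : Set ℂ} (hΩ : IsOpen Ω) (i j : Fin N) : IsOpen (pairSet Ω i j) :=
  (isOpen_set_pi Set.finite_univ fun _ _ => hΩ).inter
    ((isOpen_OcO hΩ).preimage (by fun_prop : Continuous fun x : Fin N → ℂ => (x i, x j)))

theorem statC_sq_mul_lintegral_le (α : ℝ) {u : (Fin N → ℂ) → ℂ} (hu : IsAnyonWF N u)
    {Ω : Set ℂ} (hΩ : IsOpen Ω) (hij : i ≠ j) :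
    ENNReal.ofReal (statC α N ^ 2) *
        ∫⁻ x in pairSet Ω i j, ENNReal.ofReal (‖u x‖ ^ 2 / ‖x i - x j‖ ^ 2) ≤
      ∫⁻ x in pairSet Ω i j,
        ENNReal.ofReal (‖pairCov α u i j x‖ ^ 2 / ‖x i - x j‖ ^ 2) := by
  have hE := (isOpen_pairSet hΩ i j).measurableSet
  have hinv (t : ℝ) (x : Fin N → ℂ) (hx : x ∈ pairSet Ω i j) :
      pairRot i j t x ∈ pairSet Ω i j :=
    ⟨pairRot_mem_pi hij t hx.1 hx.2, pairRot_mem_OcO hij t hx.1 hx.2⟩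
  have hmeas {f : (Fin N → ℂ) → ℂ} (hf : Measurable f) :
      Measurable fun x : Fin N → ℂ => ENNReal.ofReal (‖f x‖ ^ 2 / ‖x i - x j‖ ^ 2) :=
    ENNReal.measurable_ofReal.comp (by fun_prop)
  have hFu := hmeas hu.smooth.continuous.measurable
  have hFc := hmeas (measurable_pairCov α hu.smooth i j)
  have hπ : ENNReal.ofReal Real.pi ≠ 0 := by simpa using Real.pi_pos
  rw [← ENNReal.mul_le_mul_iff_right hπ ENNReal.ofReal_ne_top, mul_left_comm,
    lintegral_eq_lintegral_pairRot hij hE hinv hFu,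
    lintegral_eq_lintegral_pairRot hij hE hinv hFc,
    ← lintegral_const_mul' _ _ ENNReal.ofReal_ne_top]
  refine lintegral_mono_ae (ae_restrict_of_ae ?_)
  have hgen : ∀ᵐ x : Fin N → ℂ, ∀ k, k ≠ i → k ≠ j →
      ‖x k - (x i + x j) / 2‖ ≠ ‖(x i - x j) / 2‖ := by
    refine ae_all_iff.2 fun k => ?_
    by_cases hi : k = i
    · simp [hi]
    by_cases hj : k = j
    · simp [hj]
    filter_upwards [ae_norm_sub_midpoint_ne hi hj] with x hx _ _
    exact hx
  filter_upwards [hgen] with x hk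
  simp only [norm_pairRot_sub hij]
  by_cases hx : x i = x j
  · simp [hx]
  have hrot := continuous_pairRot_angle (i := i) (j := j) x
  have hconv {f : ℝ → ℂ} (hf : Continuous f) :
      ∫⁻ t in Set.Ioc 0 Real.pi, ENNReal.ofReal (‖f t‖ ^ 2 / ‖x i - x j‖ ^ 2) =
        ENNReal.ofReal ((∫ t in (0 : ℝ)..Real.pi, ‖f t‖ ^ 2) / ‖x i - x j‖ ^ 2) := by
    rw [← intervalIntegral.integral_div, intervalIntegral.integral_of_le Real.pi_pos.le,
      ofReal_integral_eq_lintegral_ofReal]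
    · exact (by fun_prop : Continuous fun t => ‖f t‖ ^ 2 / ‖x i - x j‖ ^ 2).integrableOn_Ioc
    · exact Filter.Eventually.of_forall fun t => by positivity
  rw [hconv (f := fun t => u (pairRot i j t x)) (hu.smooth.continuous.comp hrot),
    hconv (continuous_pairCov_pairRot α hu hij hx hk), ← ENNReal.ofReal_mul (by positivity),
    ← mul_div_assoc]
  gcongr
  exact statC_sq_mul_integral_le α hu hij hx hk

theorem lintegral_ofReal_sum_lt_indicator {Ω : Set ℂ} (hΩ : IsOpen Ω)
    {f : Fin N → Fin N → (Fin N → ℂ) → ℝ} (hf : ∀ i j, Measurable (f i j))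
    (hf₀ : ∀ i j x, 0 ≤ f i j x) :
    ∫⁻ x in Set.univ.pi (fun _ : Fin N => Ω), ENNReal.ofReal (∑ i : Fin N, ∑ j : Fin N,
        if i < j then (OcO Ω).indicator (fun _ => f i j x) (x i, x j) else 0) =
      ∑ i : Fin N, ∑ j : Fin N,
        if i < j then ∫⁻ x in pairSet Ω i j, ENNReal.ofReal (f i j x) else 0 := by
  have hpre (i j : Fin N) : MeasurableSet {x : Fin N → ℂ | (x i, x j) ∈ OcO Ω} :=
    ((isOpen_OcO hΩ).preimage
      (by fun_prop : Continuous fun x : Fin N → ℂ => (x i, x j))).measurableSet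
  have hterm (i j : Fin N) (x : Fin N → ℂ) :
      ENNReal.ofReal (if i < j then (OcO Ω).indicator (fun _ => f i j x) (x i, x j) else 0) =
      if i < j then {x : Fin N → ℂ | (x i, x j) ∈ OcO Ω}.indicator
        (fun x => ENNReal.ofReal (f i j x)) x else 0 := by
    by_cases hx : (x i, x j) ∈ OcO Ω <;> simp [Set.indicator, hx, apply_ite ENNReal.ofReal]
  have hnn (i j : Fin N) (x : Fin N → ℂ) :
      0 ≤ if i < j then (OcO Ω).indicator (fun _ => f i j x) (x i, x j) else 0 := by
    split_ifs
    · exact Set.indicator_nonneg (fun _ _ => hf₀ i j x) _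
    · rfl
  have hmeas (i j : Fin N) : Measurable fun x : Fin N → ℂ =>
      if i < j then {x : Fin N → ℂ | (x i, x j) ∈ OcO Ω}.indicator
        (fun x => ENNReal.ofReal (f i j x)) x else 0 := by
    split_ifs
    · exact (hf i j).ennreal_ofReal.indicator (hpre i j)
    · exact measurable_const
  simp only [ENNReal.ofReal_sum_of_nonneg fun i _ => Finset.sum_nonneg fun j _ => hnn i j _,
    ENNReal.ofReal_sum_of_nonneg fun j _ => hnn _ j _, hterm]
  rw [lintegral_finsetSum _ fun i _ => Finset.measurable_sum _ fun j _ => hmeas i j]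
  refine Finset.sum_congr rfl fun i _ => ?_
  rw [lintegral_finsetSum _ fun j _ => hmeas i j]
  refine Finset.sum_congr rfl fun j _ => ?_
  split_ifs
  · rw [setLIntegral_indicator (hpre i j), Set.inter_comm]
    rfl
  · simp

end pairPot

/-- **Theorem (many-anyon Hardy inequality).** For an open convex `Ω ⊆ ℝ²` and an
`N`-anyon wave function `u`,
`∫_{Ω^N} ∑_j |D_j u|² ≥ (4 C_{α,N}²/N) ∫_{Ω^N} ∑_{i<j} |u|²/|x_i-x_j|² χ_{Ω∘Ω}(x_i,x_j)`. -/
theorem many_anyon_hardy (α : ℝ) (N : ℕ) (hN : 2 ≤ N)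
    (Ω : Set ℂ) (hΩopen : IsOpen Ω) (hΩconv : Convex ℝ Ω)
    (u : (Fin N → ℂ) → ℂ) (hu : IsAnyonWF N u) :
    ENNReal.ofReal (4 * statC α N ^ 2 / (N : ℝ)) *
        ∫⁻ x in Set.univ.pi (fun _ : Fin N => Ω),
          ENNReal.ofReal (∑ i : Fin N, ∑ j : Fin N, if i < j then
            Set.indicator (OcO Ω) (fun _ => ‖u x‖ ^ 2 / ‖x i - x j‖ ^ 2) (x i, x j)
            else 0) ≤
      ∫⁻ x in Set.univ.pi (fun _ : Fin N => Ω),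
        ENNReal.ofReal (∑ j : Fin N, covSq α u j x) := by
  have hcov (i j : Fin N) := measurable_pairCov α hu.smooth i j
  have hu' := hu.smooth.continuous.measurable
  have hind (x : Fin N → ℂ) (i j : Fin N) (c : ℝ) (hc : 0 ≤ c) :
      (OcO Ω).indicator (fun _ => c) (x i, x j) ≤ c :=
    Set.indicator_le_self' (fun _ _ => hc) _
  calc _ = ENNReal.ofReal (4 / N) * (ENNReal.ofReal (statC α N ^ 2) * ∑ i : Fin N, ∑ j : Fin N,
        if i < j then ∫⁻ x in pairSet Ω i j, ENNReal.ofReal (‖u x‖ ^ 2 / ‖x i - x j‖ ^ 2)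
        else 0) := by
        rw [← mul_assoc, ← ENNReal.ofReal_mul (by positivity), div_mul_eq_mul_div,
          ← lintegral_ofReal_sum_lt_indicator hΩopen (fun i j => by fun_prop)
            fun i j x => by positivity]
    _ ≤ ENNReal.ofReal (4 / N) * ∑ i : Fin N, ∑ j : Fin N,
        if i < j then ∫⁻ x in pairSet Ω i j,
          ENNReal.ofReal (‖pairCov α u i j x‖ ^ 2 / ‖x i - x j‖ ^ 2) else 0 := by
        simp only [Finset.mul_sum (s := Finset.univ) (a := ENNReal.ofReal (statC α N ^ 2))]
        gcongr with i _ j _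
        split_ifs with h
        · exact statC_sq_mul_lintegral_le α hu hΩopen h.ne
        · simp
    _ = ENNReal.ofReal (4 / N) * ∫⁻ x in Set.univ.pi (fun _ : Fin N => Ω),
        ENNReal.ofReal (∑ i : Fin N, ∑ j : Fin N, if i < j then (OcO Ω).indicator
          (fun _ => ‖pairCov α u i j x‖ ^ 2 / ‖x i - x j‖ ^ 2) (x i, x j) else 0) := by
        rw [lintegral_ofReal_sum_lt_indicator hΩopen (fun i j => by fun_prop)
          fun i j x => by positivity]
    _ ≤ _ := by
        rw [← lintegral_const_mul' _ _ ENNReal.ofReal_ne_top]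
        refine lintegral_mono fun x => ?_
        rw [← ENNReal.ofReal_mul (by positivity)]
        refine ENNReal.ofReal_le_ofReal (le_trans ?_
          (four_div_mul_sum_pairCov_le α u (by omega) x))
        gcongr with i _ j _
        split_ifs
        · exact hind x i j _ (by positivity)
        · rfl

end
end
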